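/- Every connected graph that contains no induced claw, tent S_3, net, C_4, or C_5 is a proper Helly circular-arc graph. -/

import Mathlib

/-- A unit interval graph: vertices can be mapped to reals so that two distinct
vertices are adjacent iff their images are within distance 1. -/
def SimpleGraph.IsUnitIntervalGraph {V : Type*} (G : SimpleGraph V) : Prop :=
  ∃ f : V → ℝ, ∀ u v : V, u ≠ v → (G.Adj u v ↔ |f u - f v| ≤ 1)

/-- `f : ZMod n → V` describes a hole (induced cycle of length `n ≥ 4`) of `G`. -/
def SimpleGraph.IsHoleOn {V : Type*} (G : SimpleGraph V) (n : ℕ) (f : ZMod n → V) : Prop :=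
  4 ≤ n ∧ Function.Injective f ∧
    ∀ i j : ZMod n, (G.Adj (f i) (f j) ↔ (i = j + 1 ∨ j = i + 1))

def SimpleGraph.HasHole {V : Type*} (G : SimpleGraph V) : Prop :=
  ∃ (n : ℕ) (f : ZMod n → V), G.IsHoleOn n f

/-- A graph is chordal if it has no hole. -/
def SimpleGraph.Chordal {V : Type*} (G : SimpleGraph V) : Prop := ¬ G.HasHole

/-- `G` contains an induced copy of `H`. -/
def SimpleGraph.HasInducedCopy {V W : Type*} (G : SimpleGraph V) (H : SimpleGraph W) : Prop :=
  ∃ f : W → V, Function.Injective f ∧ ∀ a b : W, G.Adj (f a) (f b) ↔ H.Adj a b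

/-- The claw `K_{1,3}`, centered at vertex `0`. -/
def clawGraph : SimpleGraph (Fin 4) := SimpleGraph.fromRel (fun a _ => a = 0)

/-- The tent `S_3`: triangle on `0,1,2`; vertex `i+3` adjacent to `{0,1,2} \ {i}`. -/
def tentGraph : SimpleGraph (Fin 6) := SimpleGraph.fromRel (fun a b =>
  (a.val < 3 ∧ b.val < 3) ∨ (a.val < 3 ∧ 3 ≤ b.val ∧ b.val ≠ a.val + 3))

/-- The net: triangle on `0,1,2`; pendant vertex `i+3` adjacent exactly to `i`. -/
def netGraph : SimpleGraph (Fin 6) := SimpleGraph.fromRel (fun a b =>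
  (a.val < 3 ∧ b.val < 3) ∨ (a.val < 3 ∧ b.val = a.val + 3))

/-- The cycle `C_n` on `ZMod n`. -/
def cycleG (n : ℕ) : SimpleGraph (ZMod n) := SimpleGraph.fromRel (fun a b => a = b + 1)

/-- The wheel `W_n`: a cycle `C_n` plus a hub (`none`) adjacent to all cycle vertices. -/
def wheelG (n : ℕ) : SimpleGraph (Option (ZMod n)) := SimpleGraph.fromRel (fun a b =>
  a = none ∨ ∃ i j : ZMod n, a = some i ∧ b = some j ∧ i = j + 1)

/-- `C*_n`: a cycle `C_n` plus an isolated vertex (`none`). -/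
def cycleStarG (n : ℕ) : SimpleGraph (Option (ZMod n)) := SimpleGraph.fromRel (fun a b =>
  ∃ i j : ZMod n, a = some i ∧ b = some j ∧ i = j + 1)

/-- Raw data of a family of closed arcs on the circle `ℝ/Lℤ`: each vertex `v` gets the
arc traversed clockwise from (the image of) `src v` to `src v + len v`. -/
structure PreArcModel (V : Type*) where
  L : ℝ
  L_pos : 0 < L
  src : V → ℝ
  len : V → ℝ
  len_pos : ∀ v, 0 < len v
  len_lt : ∀ v, len v < L

namespace PreArcModel

variable {V : Type*}

/-- The counterclockwise endpoint of the arc of `v`. -/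
noncomputable def ccp (A : PreArcModel V) (v : V) : AddCircle A.L := (A.src v : ℝ)

/-- The clockwise endpoint of the arc of `v`. -/
noncomputable def cp (A : PreArcModel V) (v : V) : AddCircle A.L :=
  ((A.src v + A.len v : ℝ) : AddCircle A.L)

/-- The closed arc assigned to `v`, as a subset of the circle. -/
noncomputable def arc (A : PreArcModel V) (v : V) : Set (AddCircle A.L) :=
  (fun x : ℝ => (x : AddCircle A.L)) '' Set.Icc (A.src v) (A.src v + A.len v)

/-- All endpoints of all arcs are pairwise distinct. -/
def EndpointsDistinct (A : PreArcModel V) : Prop :=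
  Function.Injective (fun p : V × Bool => if p.2 then A.cp p.1 else A.ccp p.1)

/-- `A` is an arc model of the graph `G`: endpoints are pairwise distinct and two
distinct vertices are adjacent iff their arcs intersect. -/
def IsModelOf (A : PreArcModel V) (G : SimpleGraph V) : Prop :=
  A.EndpointsDistinct ∧ ∀ u v : V, u ≠ v → (G.Adj u v ↔ (A.arc u ∩ A.arc v).Nonempty)

/-- No arc is properly contained in another arc. -/
def Proper (A : PreArcModel V) : Prop := ∀ u v : V, ¬ A.arc u ⊂ A.arc v

/-- Every set of pairwise intersecting arcs has a common point. -/
def Helly (A : PreArcModel V) : Prop :=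
  ∀ S : Set V, (∀ u ∈ S, ∀ v ∈ S, (A.arc u ∩ A.arc v).Nonempty) →
    (⋂ v ∈ S, A.arc v).Nonempty

/-- The set `K_A(α)` of vertices whose arc contains the point `α`. -/
noncomputable def K (A : PreArcModel V) (α : AddCircle A.L) : Set V := {v | α ∈ A.arc v}

/-- The edge set `E→_A(α)`: edges `vu` of `G` with `v ∈ K_A(α)`, `u ∉ K_A(α)`,
and `A(v)` intersecting `A(u)` from the left (`cp v ∈ A(u)`). -/
noncomputable def Eout (A : PreArcModel V) (G : SimpleGraph V) (α : AddCircle A.L) :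
    Set (Sym2 V) :=
  {e | ∃ v u : V, e = s(v, u) ∧ G.Adj v u ∧ α ∈ A.arc v ∧ α ∉ A.arc u ∧ A.cp v ∈ A.arc u}

/-- The edge set `E→_{A - Vm}(α)` of the model obtained by removing the arcs of `Vm`. -/
noncomputable def EoutAvoid (A : PreArcModel V) (G : SimpleGraph V) (Vm : Set V)
    (α : AddCircle A.L) : Set (Sym2 V) :=
  {e | ∃ v u : V, e = s(v, u) ∧ G.Adj v u ∧ v ∉ Vm ∧ u ∉ Vm ∧
    α ∈ A.arc v ∧ α ∉ A.arc u ∧ A.cp v ∈ A.arc u}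

end PreArcModel

/-- A proper Helly circular-arc graph: a graph admitting an arc model that is both
proper and Helly. -/
def SimpleGraph.IsPHCA {V : Type*} (G : SimpleGraph V) : Prop :=
  ∃ A : PreArcModel V, A.IsModelOf G ∧ A.Proper ∧ A.Helly

/-- Adjacency pattern of a fat `W_5` among the six clique-classes: classes `0..4`
form the fat hole (consecutive classes modulo 5 are completely adjacent), class `5`
is the hub (completely adjacent to everything), and each class is a clique. -/
def fatW5Rel (p q : Fin 6) : Prop :=
  p = q ∨ p = 5 ∨ q = 5 ∨ (p.val + 1) % 5 = q.val ∨ (q.val + 1) % 5 = p.val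

/-- A fat `W_5`: vertex set partitioned into six nonempty cliques with the `W_5`
adjacency pattern between the classes. -/
def SimpleGraph.IsFatW5 {V : Type*} (G : SimpleGraph V) : Prop :=
  ∃ part : V → Fin 6, Function.Surjective part ∧
    ∀ u v : V, u ≠ v → (G.Adj u v ↔ fatW5Rel (part u) (part v))

/-- `Gb` is a maximum spanning unit interval subgraph of `G`. -/
def IsMaxSpanningUIG {V : Type*} (G Gb : SimpleGraph V) : Prop :=
  Gb ≤ G ∧ Gb.IsUnitIntervalGraph ∧
    ∀ H : SimpleGraph V, H ≤ G → H.IsUnitIntervalGraph →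
      H.edgeSet.ncard ≤ Gb.edgeSet.ncard

/-- `(Vm, Em, Ep)` is an editing set of `G`: `Em` is a set of edges of `G - Vm`,
`Ep` a set of non-edges of `G - Vm`, and deleting `Em` and adding `Ep` makes
`G - Vm` a unit interval graph. -/
def IsEditingSet {V : Type*} (G : SimpleGraph V) (Vm : Set V) (Em Ep : Set (Sym2 V)) : Prop :=
  Em ⊆ G.edgeSet ∧ (∀ e ∈ Em, ∀ x ∈ e, x ∉ Vm) ∧
  (∀ e ∈ Ep, ¬ e.IsDiag ∧ e ∉ G.edgeSet ∧ ∀ x ∈ e, x ∉ Vm) ∧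
  ((SimpleGraph.fromEdgeSet ((G.edgeSet \ Em) ∪ Ep)).induce {v | v ∉ Vm}).IsUnitIntervalGraph

namespace SimpleGraph

variable {V : Type*}

/-- First-order form of the absence of induced claws, tents, nets, `C_4` and `C_5`. -/
structure IsClawTentNetFree (G : SimpleGraph V) : Prop where
  claw : ∀ c x y z, G.Adj c x → G.Adj c y → G.Adj c z → x ≠ y → x ≠ z → y ≠ z →
    ¬ G.Adj x y → ¬ G.Adj x z → ¬ G.Adj y z → False
  tent : ∀ a b c x y z, G.Adj a b → G.Adj a c → G.Adj b c →
    G.Adj x b → G.Adj x c → ¬ G.Adj x a → G.Adj y a → G.Adj y c → ¬ G.Adj y b →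
    G.Adj z a → G.Adj z b → ¬ G.Adj z c → x ≠ a → y ≠ b → z ≠ c →
    ¬ G.Adj x y → ¬ G.Adj x z → ¬ G.Adj y z → False
  net : ∀ a b c x y z, G.Adj a b → G.Adj a c → G.Adj b c →
    G.Adj x a → ¬ G.Adj x b → ¬ G.Adj x c → G.Adj y b → ¬ G.Adj y a → ¬ G.Adj y c →
    G.Adj z c → ¬ G.Adj z a → ¬ G.Adj z b →
    ¬ G.Adj x y → ¬ G.Adj x z → ¬ G.Adj y z → False
  cycle_four : ∀ a b c d, G.Adj a b → G.Adj b c → G.Adj c d → G.Adj d a → a ≠ c → b ≠ d →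
    ¬ G.Adj a c → ¬ G.Adj b d → False
  cycle_five : ∀ a b c d e, G.Adj a b → G.Adj b c → G.Adj c d → G.Adj d e → G.Adj e a →
    ¬ G.Adj a c → ¬ G.Adj a d → ¬ G.Adj b d → ¬ G.Adj b e → ¬ G.Adj c e → False

theorem isClawTentNetFree_of_not_hasInducedCopy (G : SimpleGraph V)
    (hclaw : ¬ G.HasInducedCopy clawGraph) (htent : ¬ G.HasInducedCopy tentGraph)
    (hnet : ¬ G.HasInducedCopy netGraph) (hc4 : ¬ G.HasInducedCopy (cycleG 4))
    (hc5 : ¬ G.HasInducedCopy (cycleG 5)) : G.IsClawTentNetFree where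
  claw c x y z _ _ _ _ _ _ _ _ _ := by
    have := G.ne_of_adj ‹G.Adj c x›
    have := G.ne_of_adj ‹G.Adj c y›
    have := G.ne_of_adj ‹G.Adj c z›
    refine hclaw ⟨![c, x, y, z], ?_, ?_⟩
    · intro i j
      fin_cases i <;> fin_cases j <;> simp_all [eq_comm]
    · intro i j
      fin_cases i <;> fin_cases j <;> simp_all [clawGraph, G.adj_comm]
  tent a b c x y z _ _ _ _ _ _ _ _ _ _ _ _ _ _ _ _ _ _ := by
    refine htent ⟨![a, b, c, x, y, z], ?_, ?_⟩
    · intro i j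
      fin_cases i <;> fin_cases j <;>
        first | exact fun _ => rfl | (simp; rintro rfl; simp_all [G.adj_comm])
    · intro i j
      fin_cases i <;> fin_cases j <;> simp_all [tentGraph, G.adj_comm]
  net a b c x y z _ _ _ _ _ _ _ _ _ _ _ _ _ _ _ := by
    refine hnet ⟨![a, b, c, x, y, z], ?_, ?_⟩
    · intro i j
      fin_cases i <;> fin_cases j <;>
        first | exact fun _ => rfl | (simp; rintro rfl; simp_all [G.adj_comm])
    · intro i j
      fin_cases i <;> fin_cases j <;> simp_all [netGraph, G.adj_comm]
  cycle_four a b c d _ _ _ _ _ _ _ _ := by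
    refine hc4 ⟨(![a, b, c, d] : Fin 4 → V), ?_, ?_⟩
    · intro (i : Fin 4) (j : Fin 4)
      fin_cases i <;> fin_cases j <;>
        first | exact fun _ => rfl | (simp; rintro rfl; simp_all [G.adj_comm])
    · have key : ∀ i j : Fin 4, (cycleG 4).Adj i j ↔ i ≠ j ∧ (i = j + 1 ∨ j = i + 1) :=
        fun _ _ => Iff.rfl
      intro (i : Fin 4) (j : Fin 4)
      rw [key]
      fin_cases i <;> fin_cases j <;> simp_all [G.adj_comm]
  cycle_five a b c d e _ _ _ _ _ _ _ _ _ _ := by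
    refine hc5 ⟨(![a, b, c, d, e] : Fin 5 → V), ?_, ?_⟩
    · intro (i : Fin 5) (j : Fin 5)
      fin_cases i <;> fin_cases j <;>
        first | exact fun _ => rfl | (simp; rintro rfl; simp_all [G.adj_comm])
    · have key : ∀ i j : Fin 5, (cycleG 5).Adj i j ↔ i ≠ j ∧ (i = j + 1 ∨ j = i + 1) :=
        fun _ _ => Iff.rfl
      intro (i : Fin 5) (j : Fin 5)
      rw [key]
      fin_cases i <;> fin_cases j <;> simp_all [G.adj_comm]

end SimpleGraph

namespace SimpleGraph

variable {V : Type*} {G : SimpleGraph V}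

/-- Two vertices are twins if they have the same closed neighbourhood. -/
def Twin (G : SimpleGraph V) (a b : V) : Prop :=
  ∀ c, (a = c ∨ G.Adj a c) ↔ (b = c ∨ G.Adj b c)

theorem Twin.symm {a b : V} (h : G.Twin a b) : G.Twin b a := fun c => (h c).symm

theorem Twin.adj_of_adj {a b c : V} (h : G.Twin a b) (hac : G.Adj a c) (hbc : b ≠ c) :
    G.Adj b c :=
  ((h c).1 (Or.inr hac)).resolve_left hbc

theorem Twin.eq_or_adj {a b : V} (h : G.Twin a b) : a = b ∨ G.Adj a b :=
  (h b).2 (Or.inl rfl)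

/-- An orientation of the edges between non-twin vertices that is invariant under exchanging
twins, directs every induced path on three vertices, and has no directed triangle. -/
structure IsLocalOrientation (G : SimpleGraph V) (D : V → V → Prop) : Prop where
  adj : ∀ {a b}, D a b → G.Adj a b
  not_twin : ∀ {a b}, D a b → ¬ G.Twin a b
  total : ∀ {a b}, G.Adj a b → ¬ G.Twin a b → D a b ∨ D b a
  asymm : ∀ {a b}, D a b → ¬ D b a
  path : ∀ {a b c}, G.Adj a b → G.Adj b c → ¬ G.Adj a c → a ≠ c → (D a b ↔ D b c)
  triangle : ∀ {a b c}, D a b → D b c → ¬ D c a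
  twin_left : ∀ {a b c}, G.Twin a b → D a c → D b c
  twin_right : ∀ {a b c}, G.Twin a b → D c a → D c b

namespace IsLocalOrientation

variable {D : V → V → Prop}

protected theorem swap (h : G.IsLocalOrientation D) :
    G.IsLocalOrientation (Function.swap D) where
  adj hab := (h.adj hab).symm
  not_twin hab ht := h.not_twin hab ht.symm
  total hab ht := (h.total hab ht).symm
  asymm hab := h.asymm hab
  path hab hbc hac hne :=
    (h.path hbc.symm hab.symm (fun hca => hac hca.symm) hne.symm).symm
  triangle hab hbc hca := h.triangle hbc hab hca
  twin_left ht := h.twin_right ht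
  twin_right ht := h.twin_left ht

theorem exists_witness (h : G.IsLocalOrientation D) {a b : V} (hab : D a b) :
    (∃ c, D c a ∧ ¬ G.Adj c b ∧ c ≠ b) ∨ ∃ c, D b c ∧ ¬ G.Adj a c ∧ a ≠ c := by
  have hn := h.not_twin hab
  have hadj := h.adj hab
  simp only [Twin, not_forall] at hn
  obtain ⟨c, hc⟩ := hn
  by_cases hac : a = c ∨ G.Adj a c
  · left
    have hbc : ¬ (b = c ∨ G.Adj b c) := fun hbc => hc ⟨fun _ => hbc, fun _ => hac⟩
    have hac' : G.Adj a c := by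
      rcases hac with rfl | hac
      · exact absurd (Or.inr hadj.symm) hbc
      · exact hac
    push Not at hbc
    refine ⟨c, (h.path hac'.symm hadj (fun hcb => hbc.2 hcb.symm) hbc.1.symm).2 hab,
      fun hcb => hbc.2 hcb.symm, hbc.1.symm⟩
  · right
    have hbc : b = c ∨ G.Adj b c := by tauto
    push Not at hac
    have hbc' : G.Adj b c := by
      rcases hbc with rfl | hbc
      · exact absurd hadj hac.2
      · exact hbc
    exact ⟨c, (h.path hadj hbc' hac.2 hac.1).1 hab, hac.2, hac.1⟩

end IsLocalOrientation

/-- The graph obtained by deleting all edges that meet `X`. -/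
def isolate (G : SimpleGraph V) (X : Set V) : SimpleGraph V where
  Adj a b := G.Adj a b ∧ a ∉ X ∧ b ∉ X
  symm := ⟨fun _ _ h => ⟨h.1.symm, h.2.2, h.2.1⟩⟩
  loopless := ⟨fun _ h => G.irrefl h.1⟩

theorem IsClawTentNetFree.isolate (h : G.IsClawTentNetFree) (X : Set V) :
    (G.isolate X).IsClawTentNetFree where
  claw c x y z := by
    have := h.claw c x y z
    simp only [SimpleGraph.isolate]
    grind
  tent a b c x y z := by
    have := h.tent a b c x y z
    simp only [SimpleGraph.isolate]
    grind
  net a b c x y z := by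
    have := h.net a b c x y z
    simp only [SimpleGraph.isolate]
    grind
  cycle_four a b c d := by
    have := h.cycle_four a b c d
    simp only [SimpleGraph.isolate]
    grind
  cycle_five a b c d e := by
    have := h.cycle_five a b c d e
    simp only [SimpleGraph.isolate]
    grind

/-- A vertex whose neighbours form a clique with pairwise comparable closed neighbourhoods. -/
structure IsEnd (G : SimpleGraph V) (v : V) : Prop where
  clique : ∀ {a b}, G.Adj v a → G.Adj v b → a ≠ b → G.Adj a b
  nested : ∀ {a b x y}, G.Adj v a → G.Adj v b → a ≠ b → G.Adj a x → G.Adj b y → x ≠ b → y ≠ a →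
    G.Adj b x ∨ G.Adj a y

namespace IsEnd

variable {D : V → V → Prop} {v : V}

theorem exists_witness (hv : G.IsEnd v) (hG : G.IsClawTentNetFree)
    (hD : (G.isolate {v}).IsLocalOrientation D) {a x : V} (ha : G.Adj v a)
    (hx : ¬ G.Adj v x) (hax : D a x) :
    (∃ c, D c a ∧ G.Adj v c ∧ ¬ G.Adj c x) ∨
      ∃ c, D x c ∧ ¬ G.Adj v c ∧ ¬ G.Adj a c := by
  have h1 := hD.adj hax
  rcases hD.exists_witness hax with ⟨c, hc⟩ | ⟨c, hc⟩
  · left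
    have h2 := hD.adj hc.1
    simp only [isolate, Set.mem_singleton_iff] at h1 h2 hc
    refine ⟨c, hc.1, ?_, by tauto⟩
    by_contra hvc
    exact hG.claw a v c x ha.symm h2.1.symm h1.1 (Ne.symm h2.2.1) (Ne.symm h1.2.2) hc.2.2 hvc hx
      (by tauto)
  · right
    have h2 := hD.adj hc.1
    simp only [isolate, Set.mem_singleton_iff] at h1 h2 hc
    exact ⟨c, hc.1, fun hvc => hc.2.1 ⟨hv.clique ha hvc hc.2.2, by tauto⟩, by tauto⟩

theorem not_through (hv : G.IsEnd v) (hG : G.IsClawTentNetFree)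
    (hD : (G.isolate {v}).IsLocalOrientation D) {a x y : V} (ha : G.Adj v a)
    (hx : ¬ G.Adj v x) (hy : ¬ G.Adj v y) (hax : D a x) (hya : D y a) : False := by
  have adj : ∀ {p q}, D p q → G.Adj p q ∧ p ≠ v ∧ q ≠ v := fun h => hD.adj h
  have path : ∀ {p q r}, G.Adj p q → G.Adj q r → p ≠ v → q ≠ v → r ≠ v → ¬ G.Adj p r → p ≠ r →
      (D p q ↔ D q r) := fun h1 h2 h3 h4 h5 h6 h7 =>
    hD.path ⟨h1, h3, h4⟩ ⟨h2, h4, h5⟩ (fun h => h6 h.1) h7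
  have asymm : ∀ {p q}, D p q → D q p → False := fun h h' => hD.asymm h h'
  have triangle : ∀ {p q r}, D p q → D q r → D r p → False := fun h h' h'' => hD.triangle h h' h''
  have hxy : x ≠ y := by rintro rfl; exact asymm hax hya
  have hadjxy : G.Adj x y := by
    by_contra h
    exact hG.claw a v x y ha.symm (adj hax).1 (adj hya).1.symm (Ne.symm (adj hax).2.2)
      (Ne.symm (adj hya).2.1) hxy hx hy h
  have hcy : ∀ c, D c a → G.Adj v c → G.Adj c y := by
    intro c hc hvc
    by_contra h
    exact asymm hya ((path (adj hc).1 (adj hya).1.symm (adj hc).2.1 (adj hc).2.2 (adj hya).2.1 h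
      (fun h' => hy (h' ▸ hvc))).1 hc)
  have hdx : ∀ d, D a d → G.Adj v d → G.Adj d x := by
    intro d hd hvd
    by_contra h
    exact asymm hax ((path (adj hax).1.symm (adj hd).1 (adj hax).2.2 (adj hd).2.1 (adj hd).2.2
      (fun h' => h h'.symm) (fun h' => hx (h' ▸ hvd))).2 hd)
  have hDxy : ¬ D x y := fun h => triangle hya hax h
  have nested : ∀ {c p q}, G.Adj v c → G.Adj c p → ¬ G.Adj a p → G.Adj a q → ¬ G.Adj c q →
      a ≠ c → p ≠ a → q ≠ c → False := by
    intro c p q h1 h2 h3 h4 h5 h6 h7 h8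
    rcases hv.nested ha h1 h6 h4 h2 h8 h7 with h | h <;> tauto
  rcases hv.exists_witness hG hD ha hx hax with ⟨c, hc1, hc2, hc3⟩ | ⟨c, hc1, hc2, hc3⟩ <;>
  rcases hv.exists_witness hG hD.swap ha hy hya with ⟨d, hd1, hd2, hd3⟩ | ⟨d, hd1, hd2, hd3⟩ <;>
  simp only [Function.swap] at hd1
  · have h1 := hcy c hc1 hc2
    have h2 := hdx d hd1 hd2
    have h3 : c ≠ d := fun h => hd3 (h ▸ h1)
    exact hG.cycle_four c y x d h1 hadjxy.symm h2.symm (hv.clique hd2 hc2 h3.symm)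
      (fun h => hx (h ▸ hc2)) (fun h => hy (h ▸ hd2)) hc3 (fun h => hd3 h.symm)
  · have h1 := hcy c hc1 hc2
    have h2 : ¬ G.Adj d c := fun h =>
      nested hc2 h.symm hd3 (adj hax).1 hc3 (adj hc1).1.ne'
        (fun h => hd2 (h ▸ ha)) (fun h => hx (h ▸ hc2))
    have h3 := (path (adj hd1).1 h1.symm (adj hd1).2.1 (adj hd1).2.2 (adj hc1).2.1 h2
      (fun h => hd2 (h ▸ hc2))).1 hd1
    exact hDxy ((path hadjxy h1.symm (adj hax).2.2 (adj hya).2.1 (adj hc1).2.1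
      (fun h => hc3 h.symm) (fun h => hx (h ▸ hc2))).2 h3)
  · have h1 := hdx d hd1 hd2
    have h2 : ¬ G.Adj d c := fun h =>
      nested hd2 h hc3 (adj hya).1.symm hd3 (adj hd1).1.ne
        (fun h => hc2 (h ▸ ha)) (fun h => hy (h ▸ hd2))
    have h3 := (path h1 (adj hc1).1 (adj hd1).2.2 (adj hc1).2.1 (adj hc1).2.2 h2
      (fun h => hc2 (h ▸ hd2))).2 hc1
    exact hDxy ((path h1 hadjxy (adj hd1).2.2 (adj hax).2.2 (adj hya).2.1 hd3
      (fun h => hy (h ▸ hd2))).1 h3)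
  · have hac : a ≠ c := fun h => hc2 (h ▸ ha)
    have had : a ≠ d := fun h => hd2 (h ▸ ha)
    have total : (G.isolate {v}).Twin y x ∨ D y x := by
      by_contra h
      push Not at h
      exact (hD.total ⟨hadjxy.symm, (adj hya).2.1, (adj hax).2.2⟩ h.1).elim h.2 hDxy
    have h1 : ¬ G.Adj c y := by
      intro h
      have h' := (path h (adj hya).1 (adj hc1).2.2 (adj hya).2.1 (adj hya).2.2
        (fun h' => hc3 h'.symm) hac.symm).2 hya
      rcases total with ht | ht
      · exact asymm (hD.twin_left ht.symm hc1) h'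
      · exact triangle hc1 h' ht
    have h2 : ¬ G.Adj d x := by
      intro h
      have h' := (path (adj hax).1 h.symm (adj hax).2.1 (adj hax).2.2 (adj hd1).2.1 hd3 had).1 hax
      rcases total with ht | ht
      · exact asymm (hD.twin_right ht hd1) h'
      · exact triangle h' hd1 ht
    have h3 : ¬ G.Adj c d := fun h =>
      hG.cycle_four c x y d (adj hc1).1.symm hadjxy (adj hd1).1.symm h.symm
        (fun h' => hDxy (h' ▸ hc1)) (fun h' => hDxy (h' ▸ hd1))
        h1 (fun h' => h2 h'.symm)
    exact hG.net a x y v c d (adj hax).1 (adj hya).1.symm hadjxy ha hx hy (adj hc1).1.symm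
      (fun h => hc3 h.symm) h1 (adj hd1).1 (fun h => hd3 h.symm) h2 hc2 hd2 h3

theorem not_out_in_of_adj (hv : G.IsEnd v) (hG : G.IsClawTentNetFree)
    (hD : (G.isolate {v}).IsLocalOrientation D) {a b x y : V} (ha : G.Adj v a) (hb : G.Adj v b)
    (hx : ¬ G.Adj v x) (hy : ¬ G.Adj v y) (hax : D a x) (hyb : D y b) (hbx : G.Adj b x) :
    False := by
  have adj : ∀ {p q}, D p q → G.Adj p q ∧ p ≠ v ∧ q ≠ v := fun h => hD.adj h
  have path : ∀ {p q r}, G.Adj p q → G.Adj q r → p ≠ v → q ≠ v → r ≠ v → ¬ G.Adj p r → p ≠ r →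
      (D p q ↔ D q r) := fun h1 h2 h3 h4 h5 h6 h7 =>
    hD.path ⟨h1, h3, h4⟩ ⟨h2, h4, h5⟩ (fun h => h6 h.1) h7
  have hDbx : ¬ D b x := fun h => hv.not_through hG hD hb hx hy h hyb
  have hab : a ≠ b := fun h => hDbx (h ▸ hax)
  have hadj := hv.clique ha hb hab
  have hT : (G.isolate {v}).Twin x b ∨ D x b := by
    by_contra h
    push Not at h
    exact (hD.total ⟨hbx.symm, (adj hax).2.2, (adj hyb).2.2⟩ h.1).elim h.2 hDbx
  have hDab : D a b := by
    rcases hT with hT | hT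
    · exact hD.twin_right hT hax
    · by_contra h
      by_cases hab' : (G.isolate {v}).Twin a b
      · exact hDbx (hD.twin_left hab' hax)
      · rcases hD.total ⟨hadj, (adj hax).2.1, (adj hyb).2.2⟩ hab' with h' | h'
        · exact h h'
        · exact hD.triangle hax hT h'
  rcases hv.exists_witness hG hD ha hx hax with ⟨c, hc1, hc2, hc3⟩ | ⟨c, hc1, hc2, hc3⟩
  · have hbc : b ≠ c := fun h => hc3 (h ▸ hbx)
    have hbc' := hv.clique hb hc2 hbc
    have hxc : x ≠ c := fun h => hx (h ▸ hc2)
    rcases hT with hT | hT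
    · exact hc3 ((hT.symm.adj_of_adj ⟨hbc', (adj hyb).2.2, (adj hc1).2.1⟩ hxc).1.symm)
    · exact hD.triangle hc1 hDab ((path hbx.symm hbc' (adj hax).2.2 (adj hyb).2.2 (adj hc1).2.1
        (fun h => hc3 h.symm) hxc).1 hT)
  · by_cases hbc : G.Adj b c
    · have hac : a ≠ c := fun h => hc2 (h ▸ ha)
      exact hv.not_through hG hD hb hc2 hy ((path hadj hbc (adj hax).2.1 (adj hyb).2.2
        (adj hc1).2.2 hc3 hac).1 hDab) hyb
    · exact hDbx ((path hbx (adj hc1).1 (adj hyb).2.2 (adj hax).2.2 (adj hc1).2.2 hbc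
        (fun h => hc2 (h ▸ hb))).2 hc1)

theorem not_out_in (hv : G.IsEnd v) (hG : G.IsClawTentNetFree)
    (hD : (G.isolate {v}).IsLocalOrientation D) {a b x y : V} (ha : G.Adj v a) (hb : G.Adj v b)
    (hx : ¬ G.Adj v x) (hy : ¬ G.Adj v y) (hax : D a x) (hyb : D y b) : False := by
  by_cases hab : a = b
  · subst hab
    exact hv.not_through hG hD ha hx hy hax hyb
  · rcases hv.nested ha hb hab (hD.adj hax).1 (hD.adj hyb).1.symm (fun h => hx (h ▸ hb))
      (fun h => hy (h ▸ ha)) with h | h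
    · exact hv.not_out_in_of_adj hG hD ha hb hx hy hax hyb h
    · exact hv.not_out_in_of_adj hG hD.swap hb ha hy hx hyb hax h

/-- The extension to an end vertex `v` of an orientation of the rest of the graph. -/
def Extend (G : SimpleGraph V) (v : V) (D : V → V → Prop) (p q : V) : Prop :=
  D p q ∨ (G.Adj v p ∧ q ≠ v ∧ ¬ G.Adj v q ∧ G.Adj p q) ∨
    (p = v ∧ G.Adj v q ∧ ∃ w, G.Adj q w ∧ w ≠ v ∧ ¬ G.Adj v w)

theorem isLocalOrientation_extend (hv : G.IsEnd v)
    (hD : (G.isolate {v}).IsLocalOrientation D)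
    (hout : ∀ a x, G.Adj v a → ¬ G.Adj v x → ¬ D x a) :
    G.IsLocalOrientation (Extend G v D) := by
  have adj : ∀ p q, D p q → G.Adj p q ∧ p ≠ v ∧ q ≠ v := fun p q h => hD.adj h
  have path : ∀ p q r, G.Adj p q → G.Adj q r → p ≠ v → q ≠ v → r ≠ v → ¬ G.Adj p r → p ≠ r →
      (D p q ↔ D q r) := fun p q r h1 h2 h3 h4 h5 h6 h7 =>
    hD.path ⟨h1, h3, h4⟩ ⟨h2, h4, h5⟩ (fun h => h6 h.1) h7
  have asymm : ∀ p q, D p q → D q p → False := fun p q h h' => hD.asymm h h'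
  have triangle : ∀ p q r, D p q → D q r → D r p → False :=
    fun p q r h h' h'' => hD.triangle h h' h''
  have twin : ∀ p q, G.Twin p q → p ≠ v → q ≠ v → (G.isolate {v}).Twin p q := by
    intro p q h hp hq c
    have := h c
    simp only [isolate, Set.mem_singleton_iff]
    grind
  have symm : ∀ p q, G.Adj p q → G.Adj q p := fun p q h => h.symm
  have irrefl : ∀ p, ¬ G.Adj p p := fun p => G.irrefl
  have clique := @clique _ _ _ hv
  have total : ∀ p q, G.Adj p q → p ≠ v → q ≠ v → D p q ∨ D q p ∨ (G.isolate {v}).Twin p q := by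
    intro p q h1 h2 h3
    have := @IsLocalOrientation.total _ _ _ hD p q ⟨h1, h2, h3⟩
    tauto
  have ntw : ∀ p q, G.Adj p q → ¬ G.Twin p q → ∃ w, (G.Adj p w ∧ w ≠ q ∧ ¬ G.Adj q w) ∨
      (G.Adj q w ∧ w ≠ p ∧ ¬ G.Adj p w) := by
    intro p q h1 h2
    unfold Twin at h2
    push Not at h2
    obtain ⟨w, hw⟩ := h2
    refine ⟨w, ?_⟩
    grind
  have htwin : ∀ p q, (G.isolate {v}).Twin p q → p ≠ v → q ≠ v → ∀ r, r ≠ v → r ≠ p → r ≠ q →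
      (G.Adj p r ↔ G.Adj q r) := by
    intro p q h hp hq r h1 h2 h3
    have := h r
    simp only [isolate, Set.mem_singleton_iff] at this
    grind
  have twinK : ∀ p q, p ≠ v → q ≠ v → (G.Adj v p ↔ G.Adj v q) → (G.isolate {v}).Twin p q →
      G.Twin p q := by
    intro p q hp hq hpq h c
    have h1 := h c
    have h2 := h q
    simp only [isolate, Set.mem_singleton_iff] at h1 h2
    grind
  have not_twin : ∀ a b, Extend G v D a b → ¬ G.Twin a b := by
    intro a b hab ht
    have h1 := ht v
    have h2 := twin a b ht
    have h3 := @IsLocalOrientation.not_twin _ _ _ hD a b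
    unfold Extend at hab
    unfold Twin at ht
    rcases hab with hab | hab | ⟨h4, h5, w, h6, h7, h8⟩
    · grind
    · grind
    · have := ht w
      grind
  constructor
  · intro a b hab
    unfold Extend at hab
    grind
  · exact fun {a b} => not_twin a b
  · intro a b hab ht
    have h1 := total a b hab
    have h2 := ntw a b hab ht
    have h3 := twinK a b
    unfold Extend
    by_cases hav : a = v
    · subst hav
      grind
    by_cases hbv : b = v
    · subst hbv
      grind
    grind
  · intro a b hab hba
    unfold Extend at hab hba
    grind
  · intro a b c hab hbc hac hne
    have h1 := path a b c hab hbc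
    have h2 := total a b hab
    have h3 := total b c hbc
    have h4 := htwin a b
    have h5 := htwin b c
    unfold Extend
    by_cases hav : a = v
    · subst hav
      grind
    by_cases hbv : b = v
    · subst hbv
      grind
    by_cases hcv : c = v
    · subst hcv
      grind
    have h6 : ¬ (G.isolate {v}).Twin a b := by grind
    have h7 : ¬ (G.isolate {v}).Twin b c := by grind
    grind
  · intro a b c hab hbc hca
    unfold Extend at hab hbc hca
    grind
  · intro a b c ht hac
    have hn := not_twin a c hac
    unfold Extend at hac ⊢
    have hcv : c ≠ v := by grind
    by_cases hab : a = b
    · grind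
    have hb := ht v
    have hc := ht c
    by_cases hav : a = v
    · subst hav
      have h1 := ht b
      obtain ⟨h3, w, h4, h5, h6⟩ : G.Adj a c ∧ ∃ w, G.Adj c w ∧ w ≠ a ∧ ¬ G.Adj a w := by grind
      have hw := ht w
      have h7 := path b c w
      have h8 := total c w h4
      have h9 := htwin c w
      grind
    by_cases hbv : b = v
    · subst hbv
      have h1 : D a c ∧ G.Adj b c := by grind
      have h2 := adj a c h1.1
      obtain ⟨w, hw⟩ := ntw a c h2.1 hn
      have := ht w
      grind
    have h1 := @IsLocalOrientation.twin_left _ _ _ hD a b c (twin a b ht hav hbv)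
    grind
  · intro a b c ht hac
    have hn := not_twin c a hac
    unfold Extend at hac ⊢
    by_cases hab : a = b
    · grind
    have hb := ht v
    have hc := ht c
    have hav : a ≠ v := by grind
    by_cases hcv : c = v
    · subst hcv
      obtain ⟨h3, w, h4, h5, h6⟩ : G.Adj c a ∧ ∃ w, G.Adj a w ∧ w ≠ c ∧ ¬ G.Adj c w := by grind
      have hw := ht w
      grind
    by_cases hbv : b = v
    · subst hbv
      have h1 : D c a ∧ G.Adj b c := by grind
      have h2 := adj c a h1.1
      obtain ⟨w, hw⟩ := ntw c a h2.1 hn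
      have h3 := ht w
      have h4 := path w c a
      grind
    have h1 := @IsLocalOrientation.twin_right _ _ _ hD a b c (twin a b ht hav hbv)
    grind

theorem exists_isLocalOrientation (hv : G.IsEnd v) (hG : G.IsClawTentNetFree)
    (hD : (G.isolate {v}).IsLocalOrientation D) : ∃ D', G.IsLocalOrientation D' := by
  by_cases hout : ∀ a x, G.Adj v a → ¬ G.Adj v x → ¬ D x a
  · exact ⟨_, hv.isLocalOrientation_extend hD hout⟩
  · push Not at hout
    obtain ⟨b, y, hb, hy, hyb⟩ := hout
    exact ⟨_, hv.isLocalOrientation_extend hD.swap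
      fun a x ha hx hax => hv.not_out_in hG hD ha hb hx hy hax hyb⟩

end IsEnd

end SimpleGraph

namespace SimpleGraph

variable {V : Type*} {G : SimpleGraph V}

theorem IsClawTentNetFree.exists_isEnd [Finite V] (hG : G.IsClawTentNetFree) {u v w₀ : V}
    (huv : G.Adj u v) (hw₀ : G.Adj v w₀ ∧ ¬ G.Adj w₀ u ∧ w₀ ≠ u)
    (hM : ∀ w, G.Adj v w → ¬ G.Adj w u → w ≠ u → ∀ z, G.Adj w z → z = v ∨ G.Adj v z) :
    ∃ w, G.Adj v w ∧ G.IsEnd w := by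
  obtain ⟨w, ⟨hvw, hwu, hwu'⟩, hmin⟩ := Set.exists_min_image
    {w | G.Adj v w ∧ ¬ G.Adj w u ∧ w ≠ u} (fun w => {z | G.Adj w z ∧ G.Adj u z}.ncard)
    (Set.toFinite _) ⟨w₀, hw₀⟩
  have hmin' : ∀ b a, G.Adj v b → ¬ G.Adj b u → b ≠ u → G.Adj w a → G.Adj u a → ¬ G.Adj b a →
      ∃ z, G.Adj b z ∧ G.Adj u z ∧ ¬ G.Adj w z := by
    intro b a h1 h2 h3 h4 h5 h6
    by_contra! h
    refine absurd (hmin b ⟨h1, h2, h3⟩) (not_le.2 (Set.ncard_lt_ncard ?_ (Set.toFinite _)))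
    exact ⟨fun z hz => ⟨h z hz.1 hz.2, hz.2⟩, fun hsub => h6 (hsub ⟨h4, h5⟩).1⟩
  clear hmin
  have symm : ∀ p q, G.Adj p q → G.Adj q p := fun p q h => h.symm
  have ne : ∀ p q r, G.Adj p r → ¬ G.Adj q r → p ≠ q := fun p q r h h' e => h' (e ▸ h)
  have irrefl : ∀ p, ¬ G.Adj p p := fun p => G.irrefl
  have hNw := hM w hvw hwu hwu'
  have key : ∀ a b, G.Adj w a → G.Adj w b → a ≠ b → ¬ G.Adj a b → G.Adj a u → False := by
    intro a b ha hb hab hadj hau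
    have hbu : ¬ G.Adj b u := by
      intro hbu
      have := hG.cycle_four u a w b
      grind
    have hva := hNw a ha
    have hvb := hNw b hb
    obtain ⟨z, hz1, hz2, hz3⟩ := hmin' b a (by grind) hbu (by grind) ha hau.symm (by grind)
    have h1 := hG.cycle_four a w b z
    have h2 := hG.cycle_five u a w b z
    grind
  have clique : ∀ a b, G.Adj w a → G.Adj w b → a ≠ b → G.Adj a b := by
    intro a b ha hb hab
    by_contra hadj
    have h1 := key a b ha hb hab hadj
    have h2 := key b a hb ha hab.symm (fun h => hadj h.symm)
    have h3 := hG.claw v u a b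
    have hua : u ≠ a := fun h => hwu (h ▸ ha)
    have hub : u ≠ b := fun h => hwu (h ▸ hb)
    have hva := hNw a ha
    have hvb := hNw b hb
    grind
  have key2 : ∀ a b x y, G.Adj w a → G.Adj w b → a ≠ b → G.Adj a x → G.Adj b y → x ≠ b → y ≠ a →
      ¬ G.Adj b x → ¬ G.Adj a y → G.Adj b u → False := by
    intro a b x y ha hb hab hax hby hxb hya hbx hay hbu
    have hadj := clique a b ha hb hab
    have hwx : ¬ G.Adj w x := fun h => hbx (clique b x hb h (Ne.symm hxb))
    have hwy : ¬ G.Adj w y := fun h => hay (clique a y ha h (Ne.symm hya))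
    have hxy : ¬ G.Adj x y := by
      have := hG.cycle_four a x y b
      grind
    by_cases hav : a = v
    · subst hav
      have h1 := hG.claw a u x w
      have h2 := hG.claw b u w y
      have h3 := hG.tent a b u y x w
      grind
    by_cases hbv : b = v
    · subst hbv
      have h0 := hM a
      have h1 := hG.claw b u y w
      have h2 := hG.claw a u w x
      have h3 := hG.tent b a u x y w
      grind
    have hva := hNw a ha
    have hvb := hNw b hb
    by_cases hau : G.Adj a u
    · have h1 := hG.claw a u w x
      have h2 := hG.claw b u w y
      have h3 := hG.tent a b u y x w
      grind
    · have h0 := hM a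
      have h1 := hG.claw v u x w
      have h2 := hG.cycle_four a x u b
      grind
  refine ⟨w, hvw, ⟨fun ha hb hab => clique _ _ ha hb hab, ?_⟩⟩
  intro a b x y ha hb hab hax hby hxb hya
  by_contra! h
  have h1 := key2 a b x y ha hb hab hax hby hxb hya h.1 h.2
  have h2 := key2 b a y x hb ha hab.symm hby hax hya hxb h.2 h.1
  have hadj := clique a b ha hb hab
  have hwx : ¬ G.Adj w x := fun h' => h.1 (clique b x hb h' (Ne.symm hxb))
  have hwy : ¬ G.Adj w y := fun h' => h.2 (clique a y ha h' (Ne.symm hya))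
  have hxy : ¬ G.Adj x y := by
    have := hG.cycle_four a x y b
    grind
  have hva := hNw a ha
  have hvb := hNw b hb
  have h0 := hM a
  have h3 := hM b
  have h4 := hG.claw v w x y
  have h5 : x ≠ y := fun h' => h.1 (h' ▸ hby)
  have h6 : w ≠ x := fun h' => h.1 (h' ▸ hb.symm)
  have h7 : w ≠ y := fun h' => h.2 (h' ▸ ha.symm)
  have h8 : a ≠ u := fun h' => hwu (h' ▸ ha)
  have h9 : b ≠ u := fun h' => hwu (h' ▸ hb)
  have h10 : x ≠ v := fun h' => hwx (h' ▸ hvw.symm)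
  have h11 : y ≠ v := fun h' => hwy (h' ▸ hvw.symm)
  grind

/-- The values of `f` on `0, …, k - 1` form an induced cycle of length `k ≥ 4`. -/
structure IsInducedCycle (G : SimpleGraph V) (k : ℕ) (f : ℕ → V) : Prop where
  four_le : 4 ≤ k
  ne : ∀ {i j}, i < j → j < k → f i ≠ f j
  adj_iff : ∀ {i j}, i < j → j < k → (G.Adj (f i) (f j) ↔ j = i + 1 ∨ (i = 0 ∧ j + 1 = k))

theorem exists_isInducedCycle_of_walk [Finite V] {f : ℕ → V}
    (hf : ∀ i, G.Adj (f i) (f (i + 1))) (hf' : ∀ i, ¬ G.Adj (f i) (f (i + 2)))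
    (hne : ∀ i, f i ≠ f (i + 2)) : ∃ k g, G.IsInducedCycle k g := by
  classical
  have hex : ∃ g, 2 ≤ g ∧ ∃ i, f i = f (i + g) ∨ G.Adj (f i) (f (i + g)) := by
    obtain ⟨a, b, hab, hne'⟩ : ∃ a b, f a = f b ∧ a ≠ b := by
      have := not_injective_infinite_finite f
      simpa [Function.Injective] using this
    wlog h : a < b generalizing a b
    · exact this b a hab.symm hne'.symm (by omega)
    have h1 : b ≠ a + 1 := by
      rintro rfl
      exact G.irrefl (hab ▸ hf a)
    refine ⟨b - a, by omega, a, Or.inl ?_⟩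
    rw [hab]
    congr 1
    omega
  obtain ⟨hg, i, hi⟩ := Nat.find_spec hex
  have hmin := fun m => @Nat.find_min _ _ hex m
  set g := Nat.find hex with hgdef
  have hg3 : 3 ≤ g := by
    by_contra h
    have h2 : g = 2 := by omega
    rw [h2] at hi
    exact hi.elim (hne i) (hf' i)
  have hfar : ∀ a b, a + 2 ≤ b → b < a + g → f a ≠ f b ∧ ¬ G.Adj (f a) (f b) := by
    intro a b h1 h2
    have h3 := hmin (b - a) (by omega)
    push Not at h3
    have h4 := h3 (by omega) a
    rwa [show a + (b - a) = b by omega] at h4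
  have hadj : G.Adj (f i) (f (i + g)) := by
    refine hi.resolve_left fun h => ?_
    exact (hfar (i + 1) (i + g) (by omega) (by omega)).2 (h ▸ (hf i).symm)
  refine ⟨g + 1, fun j => f (i + j), by omega, ?_, ?_⟩
  · intro a b hab hb
    by_cases h1 : b = a + 1
    · subst h1
      exact (hf (i + a)).ne
    by_cases h2 : b = g ∧ a = 0
    · obtain ⟨rfl, rfl⟩ := h2
      exact hadj.ne
    exact (hfar (i + a) (i + b) (by omega) (by omega)).1
  · intro a b hab hb
    by_cases h1 : b = a + 1
    · subst h1
      simpa [← add_assoc] using hf (i + a)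
    by_cases h2 : b = g ∧ a = 0
    · obtain ⟨rfl, rfl⟩ := h2
      simpa using hadj
    have := (hfar (i + a) (i + b) (by omega) (by omega)).2
    simp only [this, false_iff]
    omega

theorem IsClawTentNetFree.exists_isInducedCycle [Finite V] (hG : G.IsClawTentNetFree)
    (hend : ∀ x y, G.Adj x y → ¬ G.IsEnd x) {u v w : V} (huv : G.Adj u v) (hvw : G.Adj v w)
    (hwu : ¬ G.Adj w u) (hne : w ≠ u) : ∃ k g, G.IsInducedCycle k g := by
  let S := {p : V × V // G.Adj p.1 p.2 ∧ ∃ w, G.Adj p.2 w ∧ ¬ G.Adj w p.1 ∧ w ≠ p.1}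
  have step : ∀ s : S, ∃ t : S, t.1.1 = s.1.2 ∧ ¬ G.Adj t.1.2 s.1.1 ∧ t.1.2 ≠ s.1.1 := by
    rintro ⟨⟨a, b⟩, hab, c, hc⟩
    by_contra! h
    obtain ⟨d, hd1, hd2⟩ := hG.exists_isEnd hab hc fun d h1 h2 h3 z hz => by
      by_contra! hz'
      exact h3 (h ⟨(b, d), h1, z, hz, fun h' => hz'.2 h'.symm, hz'.1⟩ rfl h2)
    exact hend d b hd1.symm hd2
  choose next h1 h2 h3 using step
  let s : ℕ → S := fun i => next^[i] ⟨(u, v), huv, w, hvw, hwu, hne⟩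
  have hs : ∀ i, s (i + 1) = next (s i) := fun i => Function.iterate_succ_apply' _ _ _
  have hs1 : ∀ i, (s (i + 1)).1.1 = (s i).1.2 := fun i => by rw [hs, h1]
  have hs2 : ∀ i, (s (i + 2)).1.1 = (next (s i)).1.2 := fun i => by rw [hs1, hs]
  refine exists_isInducedCycle_of_walk (f := fun i => (s i).1.1) (fun i => ?_) (fun i h => ?_)
    (fun i h => ?_)
  · simp only [hs1]
    exact (s i).2.1
  · simp only [hs2] at h
    exact h2 _ h.symm
  · simp only [hs2] at h
    exact h3 _ h.symm

end SimpleGraph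

namespace SimpleGraph

variable {V : Type*} {G : SimpleGraph V}

/-- A bi-infinite periodic enumeration of an induced cycle of length `k ≥ 6` in a graph that has
no induced cycle of length `k - 1`. -/
structure IsTightHole (G : SimpleGraph V) (k : ℤ) (h : ℤ → V) : Prop where
  six_le : 6 ≤ k
  periodic : ∀ a m, h (a + k * m) = h a
  adj_succ : ∀ a, G.Adj (h a) (h (a + 1))
  not_adj : ∀ {a b}, a + 2 ≤ b → b + 2 ≤ a + k → ¬ G.Adj (h a) (h b)
  ne : ∀ {a b}, a < b → b < a + k → h a ≠ h b
  shortest : ∀ (n : ℕ) (f : ℕ → V), (n : ℤ) + 1 = k → ¬ G.IsInducedCycle n f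

/-- `v` sees exactly the vertices `h j` with `|2 j - P| ≤ 2` modulo the period. -/
def HasPos (G : SimpleGraph V) (k : ℤ) (h : ℤ → V) (v : V) (P : ℤ) : Prop :=
  ∀ j, (v = h j ∨ G.Adj v (h j)) ↔ ∃ m, -2 ≤ 2 * (j + k * m) - P ∧ 2 * (j + k * m) - P ≤ 2

theorem Twin.hasPos {k : ℤ} {h : ℤ → V} {u v : V} {P : ℤ} (ht : G.Twin u v)
    (hP : G.HasPos k h u P) : G.HasPos k h v P := fun j => (ht (h j)).symm.trans (hP j)

theorem exists_eq_of_mul_lt {k m : ℤ} (hk : 0 < k) (h1 : -(2 * k) < k * m) (h2 : k * m < 2 * k) :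
    m = -1 ∨ m = 0 ∨ m = 1 := by
  have h3 : m < 2 := by nlinarith
  have h4 : -2 < m := by nlinarith
  omega

theorem IsInducedCycle.isTightHole {n : ℕ} {f : ℕ → V} (hf : G.IsInducedCycle n f) (hn : 6 ≤ n)
    (hmin : ∀ m g, m < n → ¬ G.IsInducedCycle m g) :
    G.IsTightHole n (fun j => f (j % n).toNat) where
  six_le := by exact_mod_cast hn
  periodic a m := by simp
  adj_succ a := by
    have h0 : (0 : ℤ) < n := by omega
    have h1 := Int.emod_nonneg a h0.ne'
    have h2 := Int.emod_lt_of_pos a h0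
    have h3 : (a + 1) % n = (a % n + 1) % n := by simp [Int.add_emod]
    simp only [h3]
    by_cases h4 : a % n + 1 = n
    · rw [h4, Int.emod_self, G.adj_comm]
      exact (hf.adj_iff (by omega) (by omega)).2 (by omega)
    · rw [Int.emod_eq_of_lt (a := a % n + 1) (by omega) (by omega)]
      exact (hf.adj_iff (by omega) (by omega)).2 (by omega)
  not_adj {a b} hab hba := by
    have h0 : (0 : ℤ) < n := by omega
    have h1 := Int.emod_nonneg a h0.ne'
    have h2 := Int.emod_lt_of_pos a h0
    have h3 := Int.emod_nonneg b h0.ne'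
    have h4 := Int.emod_lt_of_pos b h0
    have h5 := Int.emod_add_mul_ediv a n
    have h6 := Int.emod_add_mul_ediv b n
    have h7 := @exists_eq_of_mul_lt n (b / n - a / n) h0
    rw [mul_sub] at h7
    have h8 : b / (n : ℤ) - a / n = -1 ∨ b / (n : ℤ) - a / n = 0 ∨ b / (n : ℤ) - a / n = 1 :=
      h7 (by omega) (by omega)
    have h9 : (n : ℤ) * (b / n) = n * (a / n) + n * (b / n - a / n) := by ring
    intro h
    rcases lt_trichotomy (a % n) (b % n) with hlt | heq | hlt
    · rw [hf.adj_iff (by omega) (by omega)] at h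
      rcases h8 with h8 | h8 | h8 <;> rw [h8] at h9 <;> omega
    · rw [heq] at h
      exact G.irrefl h
    · rw [G.adj_comm, hf.adj_iff (by omega) (by omega)] at h
      rcases h8 with h8 | h8 | h8 <;> rw [h8] at h9 <;> omega
  ne {a b} hab hba := by
    have h0 : (0 : ℤ) < n := by omega
    have h1 := Int.emod_nonneg a h0.ne'
    have h2 := Int.emod_lt_of_pos a h0
    have h3 := Int.emod_nonneg b h0.ne'
    have h4 := Int.emod_lt_of_pos b h0
    intro h
    rcases lt_trichotomy (a % n) (b % n) with hlt | heq | hlt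
    · exact hf.ne (by omega) (by omega) h
    · have h5 := Int.emod_add_mul_ediv a n
      have h6 := Int.emod_add_mul_ediv b n
      have h9 : (n : ℤ) * (b / n) = n * (a / n) + n * (b / n - a / n) := by ring
      rcases @exists_eq_of_mul_lt n (b / n - a / n) h0 (by omega) (by omega) with h8 | h8 | h8 <;>
        rw [h8] at h9 <;> omega
    · exact hf.ne (by omega) (by omega) h.symm
  shortest m g hm := hmin m g (by omega)

namespace IsTightHole

variable {k : ℤ} {h : ℤ → V}

protected theorem reverse (hh : G.IsTightHole k h) : G.IsTightHole k (fun j => h (-j)) where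
  six_le := hh.six_le
  periodic a m := by
    rw [show -(a + k * m) = -a + k * (-m) by ring, hh.periodic]
  adj_succ a := by
    have := (hh.adj_succ (-(a + 1))).symm
    rwa [show -(a + 1) + 1 = -a by ring] at this
  not_adj h1 h2 h3 := hh.not_adj (by omega) (by omega) h3.symm
  ne h1 h2 h3 := hh.ne (by omega) (by omega) h3.symm
  shortest := hh.shortest

theorem adj (hh : G.IsTightHole k h) {a b : ℤ} (hab : a - b = 1 ∨ a - b = -1) :
    G.Adj (h a) (h b) := by
  rcases hab with hab | hab
  · have := (hh.adj_succ b).symm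
    rwa [show b + 1 = a by omega] at this
  · have := hh.adj_succ a
    rwa [show a + 1 = b by omega] at this

theorem not_adj' (hh : G.IsTightHole k h) {a b : ℤ} (hab : 2 ≤ a - b ∨ 2 ≤ b - a)
    (h1 : a - b ≤ k - 2) (h2 : b - a ≤ k - 2) : ¬ G.Adj (h a) (h b) := by
  rcases hab with hab | hab
  · exact fun h' => hh.not_adj (by omega) (by omega) h'.symm
  · exact hh.not_adj (by omega) (by omega)

theorem ne' (hh : G.IsTightHole k h) {a b : ℤ} (hab : a ≠ b)
    (h1 : a - b < k) (h2 : b - a < k) : h a ≠ h b := by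
  rcases lt_or_gt_of_ne hab with hab | hab
  · exact hh.ne (by omega) (by omega)
  · exact (hh.ne (by omega) (by omega)).symm

/-- Every integer can be moved by the period into a given window. -/
theorem exists_window (hk : 6 ≤ k) (lo j : ℤ) : ∃ m, lo ≤ j + k * m ∧ j + k * m < lo + k := by
  have h1 := Int.emod_nonneg (j - lo) (show k ≠ 0 by omega)
  have h2 := Int.emod_lt_of_pos (j - lo) (show 0 < k by omega)
  have h3 := Int.emod_add_mul_ediv (j - lo) k
  exact ⟨-((j - lo) / k), by rw [mul_neg]; omega, by rw [mul_neg]; omega⟩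

theorem hasPos_of_window (hh : G.IsTightHole k h) {v : V} {P lo : ℤ} (h1 : 2 * lo ≤ P - 2)
    (h2 : P + 2 < 2 * (lo + k)) (hv : ∀ j, lo ≤ j → j < lo + k →
      ((v = h j ∨ G.Adj v (h j)) ↔ -2 ≤ 2 * j - P ∧ 2 * j - P ≤ 2)) : G.HasPos k h v P := by
  intro j
  obtain ⟨m, hm1, hm2⟩ := exists_window hh.six_le lo j
  have h3 := hv _ hm1 hm2
  rw [hh.periodic] at h3
  rw [h3]
  refine ⟨fun h4 => ⟨m, h4⟩, fun ⟨m', h4⟩ => ?_⟩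
  have h5 : k * m' = k * m + k * (m' - m) := by ring
  have hk := hh.six_le
  rcases @exists_eq_of_mul_lt k (m' - m) (by omega) (by omega) (by omega) with h6 | h6 | h6 <;>
    rw [h6] at h5 <;> omega

theorem _root_.SimpleGraph.HasPos.add {v : V} {P : ℤ} (hP : G.HasPos k h v P) (m : ℤ) :
    G.HasPos k h v (P + 2 * (k * m)) := by
  intro j
  rw [hP j]
  constructor
  · rintro ⟨m', h1⟩
    refine ⟨m' + m, ?_⟩
    rw [mul_add k]
    omega
  · rintro ⟨m', h1⟩
    refine ⟨m' - m, ?_⟩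
    rw [mul_sub k]
    omega

theorem exists_hasPos_near (hh : G.IsTightHole k h) {v : V} {Q : ℤ} (hQ : G.HasPos k h v Q)
    (P : ℤ) : ∃ Q', G.HasPos k h v Q' ∧ Q' - P ≤ k ∧ P - Q' ≤ k := by
  have hk := hh.six_le
  have h1 := Int.emod_nonneg (Q - P + k) (show 2 * k ≠ 0 by omega)
  have h2 := Int.emod_lt_of_pos (Q - P + k) (show 0 < 2 * k by omega)
  have h3 := Int.emod_add_mul_ediv (Q - P + k) (2 * k)
  refine ⟨_, hQ.add (-((Q - P + k) / (2 * k))), ?_, ?_⟩ <;>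
  · rw [mul_assoc] at h3
    rw [mul_neg]
    omega

theorem _root_.SimpleGraph.HasPos.reverse {v : V} {P : ℤ} (hP : G.HasPos k h v P) :
    G.HasPos k (fun j => h (-j)) v (-P) := by
  intro j
  rw [hP (-j)]
  constructor
  · rintro ⟨m, h1⟩
    exact ⟨-m, by rw [mul_neg]; omega⟩
  · rintro ⟨m, h1⟩
    exact ⟨-m, by rw [mul_neg]; omega⟩

theorem eq_or_adj_iff (hh : G.IsTightHole k h) {v : V} {P j : ℤ} (hP : G.HasPos k h v P)
    (h1 : 2 * j - P < 2 * k - 2) (h2 : P - 2 * j < 2 * k - 2) :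
    (v = h j ∨ G.Adj v (h j)) ↔ -2 ≤ 2 * j - P ∧ 2 * j - P ≤ 2 := by
  rw [hP j]
  refine ⟨?_, fun h3 => ⟨0, by simpa using h3⟩⟩
  rintro ⟨m, h3⟩
  have hk := hh.six_le
  rcases @exists_eq_of_mul_lt k m (by omega) (by omega) (by omega) with h4 | h4 | h4 <;>
    rw [h4] at h3 <;> omega

theorem not_adj_of_hasPos (hh : G.IsTightHole k h) {v : V} {P j : ℤ} (hP : G.HasPos k h v P)
    (h1 : 2 * j - P < 2 * k - 2) (h2 : P - 2 * j < 2 * k - 2)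
    (h3 : 3 ≤ 2 * j - P ∨ 3 ≤ P - 2 * j) : ¬ G.Adj v (h j) ∧ v ≠ h j := by
  have := hh.eq_or_adj_iff hP h1 h2
  constructor
  · intro h4
    have := this.1 (Or.inr h4)
    omega
  · intro h4
    have := this.1 (Or.inl h4)
    omega

theorem adj_of_hasPos (hh : G.IsTightHole k h) {v : V} {P j : ℤ} (hP : G.HasPos k h v P)
    (h1 : 2 * j - P ≤ 2) (h2 : P - 2 * j ≤ 2) (h3 : 2 * j ≠ P) : G.Adj v (h j) := by
  have hk := hh.six_le
  have h4 := (hh.eq_or_adj_iff (j := j) hP (by omega) (by omega)).2 ⟨by omega, by omega⟩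
  refine h4.resolve_left ?_
  rintro rfl
  rcases lt_or_gt_of_ne h3 with h5 | h5
  · exact (hh.not_adj_of_hasPos (j := j - 1) hP (by omega) (by omega) (by omega)).1
      (hh.adj (by omega))
  · exact (hh.not_adj_of_hasPos (j := j + 1) hP (by omega) (by omega) (by omega)).1
      (hh.adj (by omega))

theorem hasPos_unique (hh : G.IsTightHole k h) {v : V} {P Q : ℤ} (hP : G.HasPos k h v P)
    (hQ : G.HasPos k h v Q) (h1 : Q - P ≤ k) (h2 : P - Q ≤ k) : P = Q := by
  wlog hPQ : P ≤ Q generalizing P Q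
  · exact (this hQ hP h2 h1 (by omega)).symm
  have hk := hh.six_le
  by_contra hne
  obtain ⟨i, hi⟩ : ∃ i, Q = 2 * i ∨ Q = 2 * i + 1 := ⟨Q / 2, by omega⟩
  by_cases h3 : Q = 2 * i + 1 ∧ Q = P + 1
  · exact (hh.not_adj_of_hasPos hQ (j := i - 1) (by omega) (by omega) (by omega)).1
      (hh.adj_of_hasPos hP (by omega) (by omega) (by omega))
  · exact (hh.not_adj_of_hasPos hP (j := i + 1) (by omega) (by omega) (by omega)).1
      (hh.adj_of_hasPos hQ (by omega) (by omega) (by omega))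

theorem hasPos_self (hh : G.IsTightHole k h) (i : ℤ) : G.HasPos k h (h i) (2 * i) := by
  have hk := hh.six_le
  refine hh.hasPos_of_window (lo := i - 1) (by omega) (by omega) fun j h1 h2 => ?_
  constructor
  · intro h3
    by_contra h4
    exact h3.elim (hh.ne' (by omega) (by omega) (by omega))
      (hh.not_adj' (by omega) (by omega) (by omega))
  · intro h3
    by_cases h4 : i = j
    · exact Or.inl (h4 ▸ rfl)
    · exact Or.inr (hh.adj (by omega))

end IsTightHole

end SimpleGraph

namespace SimpleGraph

variable {V : Type*} {G : SimpleGraph V}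

namespace IsTightHole

variable {k : ℤ} {h : ℤ → V}

theorem exists_boundary (hh : G.IsTightHole k h) (hG : G.IsClawTentNetFree) {v : V}
    {j : ℤ} (hj : G.Adj v (h j)) :
    ∃ i, ¬ G.Adj v (h (i - 1)) ∧ G.Adj v (h i) := by
  have hk := hh.six_le
  by_contra! hc
  have hdown : ∀ n : ℕ, G.Adj v (h (j - n)) := by
    intro n
    induction n with
    | zero => simpa using hj
    | succ n ih =>
      by_contra h1
      exact hc (j - n) (by rwa [show j - (n : ℤ) - 1 = j - ((n + 1 : ℕ) : ℤ) by push_cast; ring]) ih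
  have h0 := hdown 0
  have h2 := hdown 2
  have h4 := hdown 4
  exact hG.claw v _ _ _ h0 h2 h4 (hh.ne' (by omega) (by omega) (by omega))
    (hh.ne' (by omega) (by omega) (by omega)) (hh.ne' (by omega) (by omega) (by omega))
    (hh.not_adj' (by omega) (by omega) (by omega)) (hh.not_adj' (by omega) (by omega) (by omega))
    (hh.not_adj' (by omega) (by omega) (by omega))

theorem hasPos_of_three (hh : G.IsTightHole k h) (hG : G.IsClawTentNetFree) {v : V}
    (hv : ∀ j, v ≠ h j) {i : ℤ} (h0 : ¬ G.Adj v (h (i - 1))) (h1 : G.Adj v (h i))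
    (h2 : G.Adj v (h (i + 1))) (h3 : G.Adj v (h (i + 2))) : G.HasPos k h v (2 * i + 2) := by
  have hk := hh.six_le
  have hfar : ∀ j, i + 4 ≤ j → j ≤ i + k - 2 → ¬ G.Adj v (h j) := fun j hj1 hj2 hj =>
    hG.claw v _ _ _ h1 h3 hj (hh.ne' (by omega) (by omega) (by omega))
      (hh.ne' (by omega) (by omega) (by omega)) (hh.ne' (by omega) (by omega) (by omega))
      (hh.not_adj' (by omega) (by omega) (by omega))
      (hh.not_adj' (by omega) (by omega) (by omega)) (hh.not_adj' (by omega) (by omega) (by omega))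
  have h4 : ¬ G.Adj v (h (i + 3)) := by
    intro h4
    obtain ⟨n, hn⟩ : ∃ n : ℕ, (n : ℤ) + 1 = k := ⟨(k - 1).toNat, by omega⟩
    have hlast : G.Adj v (h (i + k)) := by
      have := hh.periodic i 1
      rw [mul_one] at this
      rwa [this]
    have hlast' : ¬ G.Adj v (h (i + k - 1)) := by
      have := hh.periodic (i - 1) 1
      rw [mul_one] at this
      rwa [show i + k - 1 = i - 1 + k by ring, this]
    refine hh.shortest n (fun j => if j = 0 then v else h (i + 2 + j)) hn ⟨by omega, ?_, ?_⟩
    · intro a b hab hb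
      have hb0 : b ≠ 0 := by omega
      by_cases ha0 : a = 0
      · simpa [ha0, hb0] using hv _
      · simpa [ha0, hb0] using hh.ne (show i + 2 + (a : ℤ) < i + 2 + b by omega) (by omega)
    · intro a b hab hb
      have hb0 : b ≠ 0 := by omega
      by_cases ha0 : a = 0
      · simp only [ha0, hb0, if_true, if_false]
        by_cases hb1 : b = 1
        · subst hb1
          simpa [add_assoc] using h4
        by_cases hb2 : b + 1 = n
        · rw [show i + 2 + (b : ℤ) = i + k by omega]
          simp [hlast, hb2]
        by_cases hb3 : b + 2 = n
        · rw [show i + 2 + (b : ℤ) = i + k - 1 by omega]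
          simp only [hlast', false_iff]
          omega
        · have := hfar (i + 2 + b) (by omega) (by omega)
          simp only [this, false_iff]
          omega
      · simp only [ha0, hb0, if_false, false_and, or_false]
        by_cases hb1 : b = a + 1
        · exact ⟨fun _ => hb1, fun _ => hh.adj (by omega)⟩
        · exact ⟨fun h5 => (hh.not_adj (by omega) (by omega) h5).elim, fun h5 => (hb1 h5).elim⟩
  refine hh.hasPos_of_window (lo := i - 1) (by omega) (by omega) fun j hj1 hj2 => ?_
  simp only [hv j, false_or]
  by_cases hj3 : j < i
  · rw [show j = i - 1 by omega]
    exact ⟨fun h5 => (h0 h5).elim, fun h5 => by omega⟩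
  by_cases hj4 : i + 2 < j
  · refine ⟨fun h5 => ?_, fun h5 => by omega⟩
    by_cases hj5 : j = i + 3
    · exact (h4 (hj5 ▸ h5)).elim
    · exact (hfar j (by omega) (by omega) h5).elim
  · refine ⟨fun h5 => by omega, fun h5 => ?_⟩
    rcases (by omega : j = i ∨ j = i + 1 ∨ j = i + 2) with rfl | rfl | rfl <;> assumption

theorem hasPos_of_two (hh : G.IsTightHole k h) (hG : G.IsClawTentNetFree) {v : V}
    (hv : ∀ j, v ≠ h j) {i : ℤ} (h0 : ¬ G.Adj v (h (i - 1))) (h1 : G.Adj v (h i))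
    (h2 : G.Adj v (h (i + 1))) (h3 : ¬ G.Adj v (h (i + 2))) : G.HasPos k h v (2 * i + 1) := by
  have hk := hh.six_le
  have hlast : ¬ G.Adj v (h (i + k - 1)) := by
    have := hh.periodic (i - 1) 1
    rw [mul_one] at this
    rwa [show i + k - 1 = i - 1 + k by ring, this]
  have hfar : ∀ n : ℕ, (n : ℤ) + 2 ≤ k - 1 → ¬ G.Adj v (h (i + 2 + n)) := by
    intro n
    induction n with
    | zero => exact fun _ => by simpa using h3
    | succ n ih =>
      intro hn hadj
      push_cast at hn
      have ih' := ih (by omega)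
      rw [show i + 2 + ((n + 1 : ℕ) : ℤ) = i + 3 + n by push_cast; ring] at hadj
      have hnext : G.Adj v (h (i + 4 + n)) := by
        by_contra hnext
        exact hG.claw (h (i + 3 + n)) (h (i + 2 + n)) (h (i + 4 + n)) v (hh.adj (by omega))
          (hh.adj (by omega)) hadj.symm (hh.ne' (by omega) (by omega) (by omega)) (hv _).symm
          (hv _).symm (hh.not_adj' (by omega) (by omega) (by omega)) (fun h' => ih' h'.symm)
          (fun h' => hnext h'.symm)
      by_cases hn1 : (n : ℤ) + 4 = k - 1
      · rw [show i + 4 + (n : ℤ) = i + k - 1 by omega] at hnext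
        exact hlast hnext
      by_cases hn2 : (n : ℤ) = k - 4
      · rw [show i + 3 + (n : ℤ) = i + k - 1 by omega] at hadj
        exact hlast hadj
      by_cases hn0 : n = 0
      · subst hn0
        simp only [Nat.cast_zero, add_zero] at hadj
        exact hG.cycle_four v (h (i + 1)) (h (i + 2)) (h (i + 3)) h2 (hh.adj (by omega))
          (hh.adj (by omega)) hadj.symm (hv _) (hh.ne' (by omega) (by omega) (by omega)) h3
          (hh.not_adj' (by omega) (by omega) (by omega))
      · exact hG.net v (h i) (h (i + 1)) (h (i + 3 + n)) (h (i - 1)) (h (i + 2)) h1 h2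
          (hh.adj (by omega)) hadj.symm (hh.not_adj' (by omega) (by omega) (by omega))
          (hh.not_adj' (by omega) (by omega) (by omega)) (hh.adj (by omega)) (fun h' => h0 h'.symm)
          (hh.not_adj' (by omega) (by omega) (by omega)) (hh.adj (by omega)) (fun h' => h3 h'.symm)
          (hh.not_adj' (by omega) (by omega) (by omega))
          (hh.not_adj' (by omega) (by omega) (by omega))
          (hh.not_adj' (by omega) (by omega) (by omega))
          (hh.not_adj' (by omega) (by omega) (by omega))
  refine hh.hasPos_of_window (lo := i - 1) (by omega) (by omega) fun j hj1 hj2 => ?_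
  simp only [hv j, false_or]
  by_cases hj3 : j < i
  · rw [show j = i - 1 by omega]
    exact ⟨fun h5 => (h0 h5).elim, fun h5 => by omega⟩
  by_cases hj4 : i + 1 < j
  · refine ⟨fun h5 => ?_, fun h5 => by omega⟩
    have := hfar (j - i - 2).toNat (by omega)
    rw [show i + 2 + ((j - i - 2).toNat : ℤ) = j by omega] at this
    exact (this h5).elim
  · refine ⟨fun h5 => by omega, fun h5 => ?_⟩
    rcases (by omega : j = i ∨ j = i + 1) with rfl | rfl <;> assumption

theorem exists_hasPos (hh : G.IsTightHole k h) (hG : G.IsClawTentNetFree) {v : V} {j : ℤ}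
    (hj : G.Adj v (h j)) : ∃ P, G.HasPos k h v P := by
  have hk := hh.six_le
  by_cases hv : ∃ i, v = h i
  · obtain ⟨i, rfl⟩ := hv
    exact ⟨_, hh.hasPos_self i⟩
  push Not at hv
  obtain ⟨i, h0, h1⟩ := hh.exists_boundary hG hj
  have h2 : G.Adj v (h (i + 1)) := by
    by_contra h2
    exact hG.claw (h i) (h (i - 1)) (h (i + 1)) v (hh.adj (by omega)) (hh.adj (by omega)) h1.symm
      (hh.ne' (by omega) (by omega) (by omega)) (hv _).symm (hv _).symm
      (hh.not_adj' (by omega) (by omega) (by omega)) (fun h' => h0 h'.symm) (fun h' => h2 h'.symm)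
  by_cases h3 : G.Adj v (h (i + 2))
  · exact ⟨_, hh.hasPos_of_three hG hv h0 h1 h2 h3⟩
  · exact ⟨_, hh.hasPos_of_two hG hv h0 h1 h2 h3⟩

theorem exists_hasPos_of_adj (hh : G.IsTightHole k h) (hG : G.IsClawTentNetFree) {u w : V} {P : ℤ}
    (hP : G.HasPos k h u P) (huw : G.Adj u w) : ∃ Q, G.HasPos k h w Q := by
  have hk := hh.six_le
  by_contra hw
  have hw1 : ∀ j, ¬ G.Adj (h j) w := fun j hj => hw (hh.exists_hasPos hG hj.symm)
  have hw2 : ∀ j, h j ≠ w := fun j hj => hw (hj ▸ ⟨_, hh.hasPos_self j⟩)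
  obtain ⟨i, rfl | rfl⟩ : ∃ i, P = 2 * i ∨ P = 2 * i + 1 := ⟨P / 2, by omega⟩
  · exact hG.claw u (h (i - 1)) (h (i + 1)) w (hh.adj_of_hasPos hP (by omega) (by omega) (by omega))
      (hh.adj_of_hasPos hP (by omega) (by omega) (by omega)) huw
      (hh.ne' (by omega) (by omega) (by omega)) (hw2 _) (hw2 _)
      (hh.not_adj' (by omega) (by omega) (by omega)) (hw1 _) (hw1 _)
  · exact hG.net u (h i) (h (i + 1)) w (h (i - 1)) (h (i + 2))
      (hh.adj_of_hasPos hP (by omega) (by omega) (by omega))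
      (hh.adj_of_hasPos hP (by omega) (by omega) (by omega)) (hh.adj (by omega)) huw.symm
      (fun h' => hw1 _ h'.symm) (fun h' => hw1 _ h'.symm) (hh.adj (by omega))
      (fun h' => (hh.not_adj_of_hasPos hP (by omega) (by omega) (by omega)).1 h'.symm)
      (hh.not_adj' (by omega) (by omega) (by omega)) (hh.adj (by omega))
      (fun h' => (hh.not_adj_of_hasPos hP (by omega) (by omega) (by omega)).1 h'.symm)
      (hh.not_adj' (by omega) (by omega) (by omega)) (fun h' => hw1 _ h'.symm)
      (fun h' => hw1 _ h'.symm) (hh.not_adj' (by omega) (by omega) (by omega))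

theorem adj_of_hasPos_near (hh : G.IsTightHole k h) (hG : G.IsClawTentNetFree) {u v : V} {P Q : ℤ}
    (hP : G.HasPos k h u P) (hQ : G.HasPos k h v Q) (h1 : Q - P ≤ 1) (h2 : P - Q ≤ 1)
    (huv : u ≠ v) : G.Adj u v := by
  wlog hPQ : P ≤ Q generalizing u v P Q
  · exact (this hQ hP h2 h1 huv.symm (by omega)).symm
  have hk := hh.six_le
  by_contra hadj
  obtain ⟨i, hi⟩ : ∃ i, P = 2 * i ∨ P = 2 * i + 1 := ⟨P / 2, by omega⟩
  have key : ∀ a b, a - b = 1 ∨ a - b = -1 → 2 * a ≠ P → 2 * a ≠ Q → -2 ≤ 2 * a - P →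
      2 * a - P ≤ 2 → -2 ≤ 2 * a - Q → 2 * a - Q ≤ 2 → (3 ≤ 2 * b - P ∨ 3 ≤ P - 2 * b) →
      (3 ≤ 2 * b - Q ∨ 3 ≤ Q - 2 * b) → False := by
    intro a b hab e1 e2 e3 e4 e5 e6 e7 e8
    have f1 := hh.not_adj_of_hasPos (j := b) hP (by omega) (by omega) e7
    have f2 := hh.not_adj_of_hasPos (j := b) hQ (by omega) (by omega) e8
    exact hG.claw (h a) u v (h b) (hh.adj_of_hasPos hP (by omega) (by omega) (by omega)).symm
      (hh.adj_of_hasPos hQ (by omega) (by omega) (by omega)).symm (hh.adj hab) huv f1.2 f2.2 hadj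
      f1.1 f2.1
  by_cases hc : P = 2 * i + 1 ∧ Q = P + 1
  · exact key i (i - 1) (by omega) (by omega) (by omega) (by omega) (by omega) (by omega)
      (by omega) (by omega) (by omega)
  · exact key (i + 1) (i + 2) (by omega) (by omega) (by omega) (by omega) (by omega) (by omega)
      (by omega) (by omega) (by omega)

end IsTightHole

end SimpleGraph

namespace SimpleGraph

variable {V : Type*} {G : SimpleGraph V}

/-- Some vertex placed at most three steps after `P` is adjacent to `b` but not to `a`. -/
def SeesAhead (G : SimpleGraph V) (k : ℤ) (h : ℤ → V) (P : ℤ) (a b : V) : Prop :=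
  ∃ c Q, G.HasPos k h c Q ∧ P < Q ∧ Q ≤ P + 3 ∧ G.Adj b c ∧ ¬ G.Adj a c

/-- Among two vertices placed at `P`, `a` comes before `b`. -/
def TieBefore (G : SimpleGraph V) (k : ℤ) (h : ℤ → V) (P : ℤ) (a b : V) : Prop :=
  G.SeesAhead k h P a b ∨ G.SeesAhead k (fun j => h (-j)) (-P) b a

/-- The orientation of the edges around a tight hole given by the placement of the vertices. -/
def HoleBefore (G : SimpleGraph V) (k : ℤ) (h : ℤ → V) (u v : V) : Prop :=
  G.Adj u v ∧ ∃ P Q, G.HasPos k h u P ∧ G.HasPos k h v Q ∧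
    ((P < Q ∧ Q ≤ P + 3) ∨ (P = Q ∧ G.TieBefore k h P u v))

variable {k : ℤ} {h : ℤ → V}

theorem HasPos.of_reverse {v : V} {P : ℤ} (hP : G.HasPos k (fun j => h (-j)) v P) :
    G.HasPos k h v (-P) := by
  simpa using hP.reverse

theorem TieBefore.reverse {P : ℤ} {a b : V} (ht : G.TieBefore k h P a b) :
    G.TieBefore k (fun j => h (-j)) (-P) b a := by
  simpa [TieBefore, or_comm] using ht

theorem HoleBefore.reverse {u v : V} (hd : G.HoleBefore k h u v) :
    G.HoleBefore k (fun j => h (-j)) v u := by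
  obtain ⟨hadj, P, Q, hP, hQ, hPQ⟩ := hd
  refine ⟨hadj.symm, -Q, -P, hQ.reverse, hP.reverse, ?_⟩
  rcases hPQ with hPQ | ⟨rfl, ht⟩
  · exact Or.inl (by omega)
  · exact Or.inr ⟨rfl, ht.reverse⟩

theorem HoleBefore.of_reverse {u v : V} (hd : G.HoleBefore k (fun j => h (-j)) u v) :
    G.HoleBefore k h v u := by
  simpa using hd.reverse

theorem SeesAhead.add {P : ℤ} {a b : V} (hs : G.SeesAhead k h P a b) (m : ℤ) :
    G.SeesAhead k h (P + 2 * (k * m)) a b := by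
  obtain ⟨c, Q, hQ, h1, h2, h3⟩ := hs
  exact ⟨c, _, hQ.add m, by omega, by omega, h3⟩

theorem TieBefore.add {P : ℤ} {a b : V} (ht : G.TieBefore k h P a b) (m : ℤ) :
    G.TieBefore k h (P + 2 * (k * m)) a b := by
  refine ht.imp (fun hs => hs.add m) fun hs => ?_
  have := hs.add (-m)
  rwa [show -P + 2 * (k * -m) = -(P + 2 * (k * m)) by ring] at this

namespace IsTightHole

theorem exists_eq_add (hh : G.IsTightHole k h) {v : V} {P Q : ℤ} (hP : G.HasPos k h v P)
    (hQ : G.HasPos k h v Q) : ∃ m, Q = P + 2 * (k * m) := by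
  have hk := hh.six_le
  have h1 := Int.emod_nonneg (Q - P + k) (show 2 * k ≠ 0 by omega)
  have h2 := Int.emod_lt_of_pos (Q - P + k) (show 0 < 2 * k by omega)
  have h3 := Int.emod_add_mul_ediv (Q - P + k) (2 * k)
  rw [mul_assoc] at h3
  exact ⟨_, (hh.hasPos_unique (hP.add ((Q - P + k) / (2 * k))) hQ (by omega) (by omega)).symm⟩

theorem eq_of_hasPos (hh : G.IsTightHole k h) {v : V} {P Q : ℤ} (hP : G.HasPos k h v P)
    (hQ : G.HasPos k h v Q) (h1 : Q - P < 2 * k) (h2 : P - Q < 2 * k) : P = Q := by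
  have hk := hh.six_le
  obtain ⟨m, hm⟩ := hh.exists_eq_add hP hQ
  rcases @exists_eq_of_mul_lt k m (by omega) (by omega) (by omega) with h4 | h4 | h4 <;>
    rw [h4] at hm <;> omega

theorem _root_.SimpleGraph.HoleBefore.exists_right (hh : G.IsTightHole k h) {u v : V} {P : ℤ}
    (hd : G.HoleBefore k h u v) (hP : G.HasPos k h u P) :
    ∃ Q, G.HasPos k h v Q ∧ ((P < Q ∧ Q ≤ P + 3) ∨ (P = Q ∧ G.TieBefore k h P u v)) := by
  obtain ⟨-, P', Q', hP', hQ', hPQ⟩ := hd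
  obtain ⟨m, rfl⟩ := hh.exists_eq_add hP' hP
  refine ⟨_, hQ'.add m, ?_⟩
  rcases hPQ with hPQ | ⟨rfl, ht⟩
  · exact Or.inl (by omega)
  · exact Or.inr ⟨rfl, ht.add m⟩

/-- Adjacent vertices with an even placement are close. -/
theorem not_adj_of_even (hh : G.IsTightHole k h) (hG : G.IsClawTentNetFree) {u v : V} {i Q : ℤ}
    (hP : G.HasPos k h u (2 * i)) (hQ : G.HasPos k h v Q) (h1 : Q - 2 * i ≤ k)
    (h2 : 2 * i - Q ≤ k) (h3 : 5 ≤ Q - 2 * i ∨ 5 ≤ 2 * i - Q) : ¬ G.Adj u v := by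
  have hk := hh.six_le
  intro huv
  have e1 := hh.not_adj_of_hasPos (j := i + 1) hQ (by omega) (by omega) (by omega)
  have e2 := hh.not_adj_of_hasPos (j := i - 1) hQ (by omega) (by omega) (by omega)
  exact hG.claw u (h (i + 1)) (h (i - 1)) v (hh.adj_of_hasPos hP (by omega) (by omega) (by omega))
    (hh.adj_of_hasPos hP (by omega) (by omega) (by omega)) huv
    (hh.ne' (by omega) (by omega) (by omega)) e1.2.symm e2.2.symm
    (hh.not_adj' (by omega) (by omega) (by omega)) (fun h' => e1.1 h'.symm)
    (fun h' => e2.1 h'.symm)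

theorem not_adj_of_even_four (hh : G.IsTightHole k h) {u v : V} {i : ℤ}
    (hP : G.HasPos k h u (2 * i)) (hQ : G.HasPos k h v (2 * i + 4)) : ¬ G.Adj u v := by
  have hk := hh.six_le
  intro huv
  obtain ⟨n, hn⟩ : ∃ n : ℕ, (n : ℤ) + 1 = k := ⟨(k - 1).toNat, by omega⟩
  have hP' := hP.add 1
  rw [mul_one] at hP'
  have hu : ∀ j, i + 3 ≤ j → j ≤ i + k - 1 → u ≠ h j ∧ (G.Adj u (h j) ↔ j = i + k - 1) := by
    intro j h1 h2
    by_cases h3 : j = i + k - 1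
    · have := hh.adj_of_hasPos (j := j) hP' (by omega) (by omega) (by omega)
      exact ⟨fun h' => by rw [← h'] at this; exact G.irrefl this, iff_of_true this h3⟩
    · have := hh.not_adj_of_hasPos (j := j) hP (by omega) (by omega) (by omega)
      exact ⟨this.2, iff_of_false this.1 h3⟩
  have hv : ∀ j, i + 3 ≤ j → j ≤ i + k - 1 → v ≠ h j ∧ (G.Adj v (h j) ↔ j = i + 3) := by
    intro j h1 h2
    by_cases h3 : j = i + 3
    · have := hh.adj_of_hasPos (j := j) hQ (by omega) (by omega) (by omega)
      exact ⟨fun h' => by rw [← h'] at this; exact G.irrefl this, iff_of_true this h3⟩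
    · have := hh.not_adj_of_hasPos (j := j) hQ (by omega) (by omega) (by omega)
      exact ⟨this.2, iff_of_false this.1 h3⟩
  refine hh.shortest n (fun j => if j = 0 then u else if j = 1 then v else h (i + 1 + j)) hn
    ⟨by omega, ?_, ?_⟩
  · intro a b hab hb
    have hb0 : b ≠ 0 := by omega
    by_cases ha0 : a = 0
    · by_cases hb1 : b = 1
      · simpa [ha0, hb1] using huv.ne
      · simpa [ha0, hb0, hb1] using (hu (i + 1 + b) (by omega) (by omega)).1
    have hb1 : b ≠ 1 := by omega
    by_cases ha1 : a = 1
    · simpa [ha1, hb0, hb1] using (hv (i + 1 + b) (by omega) (by omega)).1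
    · simpa [ha0, hb0, ha1, hb1] using hh.ne (show i + 1 + (a : ℤ) < i + 1 + b by omega) (by omega)
  · intro a b hab hb
    have hb0 : b ≠ 0 := by omega
    by_cases ha0 : a = 0
    · by_cases hb1 : b = 1
      · simpa [ha0, hb1] using huv
      · simp only [ha0, hb0, hb1, if_true, if_false, true_and, false_or]
        rw [(hu (i + 1 + b) (by omega) (by omega)).2]
        omega
    have hb1 : b ≠ 1 := by omega
    by_cases ha1 : a = 1
    · subst ha1
      simp only [ha0, hb0, hb1, if_true, if_false, false_and, or_false]
      rw [(hv (i + 1 + b) (by omega) (by omega)).2]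
      omega
    · simp only [ha0, hb0, ha1, hb1, if_false, false_and, or_false]
      by_cases hb2 : b = a + 1
      · exact ⟨fun _ => hb2, fun _ => hh.adj (by omega)⟩
      · exact ⟨fun h5 => (hh.not_adj (by omega) (by omega) h5).elim, fun h5 => (hb2 h5).elim⟩

theorem sub_le_of_adj (hh : G.IsTightHole k h) (hG : G.IsClawTentNetFree) {u v : V} {P Q : ℤ}
    (hP : G.HasPos k h u P) (hQ : G.HasPos k h v Q) (h1 : Q - P ≤ k) (h2 : P - Q ≤ k)
    (huv : G.Adj u v) : Q - P ≤ 3 ∧ P - Q ≤ 3 := by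
  wlog hPQ : P ≤ Q generalizing u v P Q
  · exact (this hQ hP h2 h1 huv.symm (by omega)).symm
  have hk := hh.six_le
  refine ⟨?_, by omega⟩
  by_contra h3
  obtain ⟨i, rfl | rfl⟩ : ∃ i, P = 2 * i ∨ P = 2 * i + 1 := ⟨P / 2, by omega⟩
  · by_cases h4 : Q = 2 * i + 4
    · exact hh.not_adj_of_even_four hP (h4 ▸ hQ) huv
    · exact hh.not_adj_of_even hG hP hQ h1 h2 (by omega) huv
  obtain ⟨i', rfl | rfl⟩ : ∃ i, Q = 2 * i ∨ Q = 2 * i + 1 := ⟨Q / 2, by omega⟩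
  · exact hh.not_adj_of_even hG hQ hP h2 h1 (by omega) huv.symm
  have e1 := hh.not_adj_of_hasPos (j := i + 2) hP (by omega) (by omega) (by omega)
  have u1 := hh.adj_of_hasPos (j := i + 1) hP (by omega) (by omega) (by omega)
  have e2 := hh.not_adj_of_hasPos (j := i + 1) hQ (by omega) (by omega) (by omega)
  by_cases h4 : i' = i + 2
  · exact hG.cycle_four u (h (i + 1)) (h (i + 2)) v u1 (hh.adj (by omega))
      (hh.adj_of_hasPos hQ (by omega) (by omega) (by omega)).symm huv.symm e1.2 e2.2.symm e1.1
      (fun h' => e2.1 h'.symm)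
  · have e3 := hh.not_adj_of_hasPos (j := i - 1) hP (by omega) (by omega) (by omega)
    have e4 := hh.not_adj_of_hasPos (j := i) hQ (by omega) (by omega) (by omega)
    have e5 := hh.not_adj_of_hasPos (j := i - 1) hQ (by omega) (by omega) (by omega)
    have e6 := hh.not_adj_of_hasPos (j := i + 2) hQ (by omega) (by omega) (by omega)
    exact hG.net u (h i) (h (i + 1)) v (h (i - 1)) (h (i + 2))
      (hh.adj_of_hasPos hP (by omega) (by omega) (by omega)) u1 (hh.adj (by omega)) huv.symm
      e4.1 e2.1 (hh.adj (by omega)) (fun h' => e3.1 h'.symm)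
      (hh.not_adj' (by omega) (by omega) (by omega)) (hh.adj (by omega)) (fun h' => e1.1 h'.symm)
      (hh.not_adj' (by omega) (by omega) (by omega)) e5.1 e6.1
      (hh.not_adj' (by omega) (by omega) (by omega))

theorem adj_of_one_three (hh : G.IsTightHole k h) (hG : G.IsClawTentNetFree) {a b c : V} {P : ℤ}
    (hb : G.HasPos k h b P) (ha : G.HasPos k h a (P + 1)) (hc : G.HasPos k h c (P + 3))
    (hba : G.Adj b a) (hbc : G.Adj b c) : G.Adj a c := by
  have hk := hh.six_le
  by_contra hac
  have hne : a ≠ c := fun h' => by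
    have := hh.eq_of_hasPos ha (h' ▸ hc) (by omega) (by omega)
    omega
  obtain ⟨i, rfl | rfl⟩ : ∃ i, P = 2 * i ∨ P = 2 * i + 1 := ⟨P / 2, by omega⟩
  · have e1 := hh.not_adj_of_hasPos (j := i - 1) ha (by omega) (by omega) (by omega)
    have e2 := hh.not_adj_of_hasPos (j := i - 1) hc (by omega) (by omega) (by omega)
    exact hG.claw b a c (h (i - 1)) hba hbc
      (hh.adj_of_hasPos hb (by omega) (by omega) (by omega)) hne e1.2 e2.2 hac e1.1 e2.1
  · have e1 := hh.not_adj_of_hasPos (j := i + 2) hb (by omega) (by omega) (by omega)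
    have e2 := hh.adj_of_hasPos (j := i + 2) ha (by omega) (by omega) (by omega)
    by_cases e3 : c = h (i + 2)
    · exact hac (e3 ▸ e2)
    · have e4 := ((hh.eq_or_adj_iff (j := i + 2) hc (by omega) (by omega)).2
        (by omega)).resolve_left e3
      exact hG.cycle_four b a (h (i + 2)) c hba e2 e4.symm hbc.symm e1.2 hne e1.1 hac

theorem ne_of_hasPos (hh : G.IsTightHole k h) {u v : V} {P Q : ℤ} (hP : G.HasPos k h u P)
    (hQ : G.HasPos k h v Q) (h1 : Q - P < 2 * k) (h2 : P - Q < 2 * k) (h3 : P ≠ Q) : u ≠ v :=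
  fun h' => h3 (hh.eq_of_hasPos hP (h' ▸ hQ) h1 h2)

theorem not_seesAhead_symm (hh : G.IsTightHole k h) (hG : G.IsClawTentNetFree) {a b : V} {P : ℤ}
    (ha : G.HasPos k h a P) (hb : G.HasPos k h b P) (hab : G.SeesAhead k h P a b) :
    ¬ G.SeesAhead k h P b a := by
  have hk := hh.six_le
  rintro ⟨d, R, hd, d1, d2, d3, d4⟩
  obtain ⟨c, Q, hc, c1, c2, c3, c4⟩ := hab
  have hac := hh.ne_of_hasPos ha hc (by omega) (by omega) (by omega)
  have hbd := hh.ne_of_hasPos hb hd (by omega) (by omega) (by omega)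
  have hQ : P + 2 ≤ Q := by
    by_contra h'
    exact c4 (hh.adj_of_hasPos_near hG ha hc (by omega) (by omega) hac)
  have hR : P + 2 ≤ R := by
    by_contra h'
    exact d4 (hh.adj_of_hasPos_near hG hb hd (by omega) (by omega) hbd)
  exact hG.cycle_four a b c d
    (hh.adj_of_hasPos_near hG ha hb (by omega) (by omega) fun h' => c4 (h' ▸ c3)) c3
    (hh.adj_of_hasPos_near hG hc hd (by omega) (by omega) fun h' => c4 (h' ▸ d3)) d3.symm hac hbd
    c4 d4

theorem not_seesAhead_reverse (hh : G.IsTightHole k h) (hG : G.IsClawTentNetFree) {a b : V} {P : ℤ}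
    (ha : G.HasPos k h a P) (hb : G.HasPos k h b P) (hab : G.SeesAhead k h P a b) :
    ¬ G.SeesAhead k (fun j => h (-j)) (-P) a b := by
  have hk := hh.six_le
  rintro ⟨d, R, hd, d1, d2, d3, d4⟩
  obtain ⟨c, Q, hc, c1, c2, c3, c4⟩ := hab
  replace hd := hd.of_reverse
  have hac := hh.ne_of_hasPos ha hc (by omega) (by omega) (by omega)
  have had := hh.ne_of_hasPos ha hd (by omega) (by omega) (by omega)
  have hQ : P + 2 ≤ Q := by
    by_contra h'
    exact c4 (hh.adj_of_hasPos_near hG ha hc (by omega) (by omega) hac)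
  have hR : -R ≤ P - 2 := by
    by_contra h'
    exact d4 (hh.adj_of_hasPos_near hG ha hd (by omega) (by omega) had)
  have hcd : ¬ G.Adj c d := fun h' => by
    have := hh.sub_le_of_adj hG hc hd (by omega) (by omega) h'
    omega
  exact hG.claw b a c d
    (hh.adj_of_hasPos_near hG hb ha (by omega) (by omega) fun h' => c4 (h' ▸ c3)) c3 d3 hac had
    (hh.ne_of_hasPos hc hd (by omega) (by omega) (by omega)) c4 d4 hcd

theorem not_tieBefore_symm (hh : G.IsTightHole k h) (hG : G.IsClawTentNetFree) {a b : V} {P : ℤ}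
    (ha : G.HasPos k h a P) (hb : G.HasPos k h b P) (hab : G.TieBefore k h P a b) :
    ¬ G.TieBefore k h P b a := by
  rintro (h2 | h2) <;> rcases hab with h1 | h1
  · exact hh.not_seesAhead_symm hG ha hb h1 h2
  · exact hh.not_seesAhead_reverse hG hb ha h2 h1
  · exact hh.not_seesAhead_reverse hG ha hb h1 h2
  · exact hh.reverse.not_seesAhead_symm hG hb.reverse ha.reverse h1 h2

theorem not_tieBefore_cycle (hh : G.IsTightHole k h) (hG : G.IsClawTentNetFree) {a b c : V} {P : ℤ}
    (ha : G.HasPos k h a P) (hb : G.HasPos k h b P) (hc : G.HasPos k h c P)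
    (hab : G.TieBefore k h P a b) (hbc : G.TieBefore k h P b c) : ¬ G.TieBefore k h P c a := by
  intro hca
  rcases hab with ⟨x, Q, hx, x1, x2, x3, x4⟩ | ⟨x, Q, hx, x1, x2, x3, x4⟩
  · have hcx : G.Adj c x := by
      by_contra h'
      exact hh.not_tieBefore_symm hG hb hc hbc (Or.inl ⟨x, Q, hx, x1, x2, x3, h'⟩)
    exact hh.not_tieBefore_symm hG hc ha hca (Or.inl ⟨x, Q, hx, x1, x2, hcx, x4⟩)
  · have hcx : G.Adj c x := by
      by_contra h'
      exact hh.not_tieBefore_symm hG hc ha hca (Or.inr ⟨x, Q, hx, x1, x2, x3, h'⟩)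
    exact hh.not_tieBefore_symm hG hb hc hbc (Or.inr ⟨x, Q, hx, x1, x2, hcx, x4⟩)

theorem adj_of_not_tieBefore (hh : G.IsTightHole k h) (hG : G.IsClawTentNetFree) {u v c : V}
    {P : ℤ} (hu : G.HasPos k h u P) (hv : G.HasPos k h v P) (h1 : ¬ G.TieBefore k h P u v)
    (h2 : ¬ G.TieBefore k h P v u) (huc : G.Adj u c) (hvc : v ≠ c) : G.Adj v c := by
  by_contra h3
  obtain ⟨Q₀, hQ₀⟩ := hh.exists_hasPos_of_adj hG hu huc
  obtain ⟨Q, hQ, hQ1, hQ2⟩ := hh.exists_hasPos_near hQ₀ P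
  have h4 := hh.sub_le_of_adj hG hu hQ hQ1 hQ2 huc
  rcases lt_trichotomy P Q with h5 | rfl | h5
  · exact h2 (Or.inl ⟨c, Q, hQ, h5, by omega, huc, h3⟩)
  · exact h3 (hh.adj_of_hasPos_near hG hv hQ (by omega) (by omega) hvc)
  · exact h1 (Or.inr ⟨c, -Q, hQ.reverse, by omega, by omega, huc, h3⟩)

theorem holeBefore_total (hh : G.IsTightHole k h) (hG : G.IsClawTentNetFree) {u v : V} {P : ℤ}
    (hu : G.HasPos k h u P) (huv : G.Adj u v) (ht : ¬ G.Twin u v) :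
    G.HoleBefore k h u v ∨ G.HoleBefore k h v u := by
  obtain ⟨Q₀, hQ₀⟩ := hh.exists_hasPos_of_adj hG hu huv
  obtain ⟨Q, hv, hQ1, hQ2⟩ := hh.exists_hasPos_near hQ₀ P
  have h4 := hh.sub_le_of_adj hG hu hv hQ1 hQ2 huv
  rcases lt_trichotomy P Q with h5 | rfl | h5
  · exact Or.inl ⟨huv, P, Q, hu, hv, Or.inl (by omega)⟩
  · by_cases h1 : G.TieBefore k h P u v
    · exact Or.inl ⟨huv, P, P, hu, hv, Or.inr ⟨rfl, h1⟩⟩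
    by_cases h2 : G.TieBefore k h P v u
    · exact Or.inr ⟨huv.symm, P, P, hv, hu, Or.inr ⟨rfl, h2⟩⟩
    refine (ht fun c => ⟨?_, ?_⟩).elim
    · rintro (rfl | h6)
      · exact Or.inr huv.symm
      · exact or_iff_not_imp_left.2 fun h7 => hh.adj_of_not_tieBefore hG hu hv h1 h2 h6 h7
    · rintro (rfl | h6)
      · exact Or.inr huv
      · exact or_iff_not_imp_left.2 fun h7 => hh.adj_of_not_tieBefore hG hv hu h2 h1 h6 h7
  · exact Or.inr ⟨huv.symm, Q, P, hv, hu, Or.inl (by omega)⟩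

theorem not_holeBefore_symm (hh : G.IsTightHole k h) (hG : G.IsClawTentNetFree) {a b : V}
    (hab : G.HoleBefore k h a b) : ¬ G.HoleBefore k h b a := by
  have hk := hh.six_le
  intro hba
  obtain ⟨-, P, Q, ha, hb, hPQ⟩ := hab
  obtain ⟨R, hR, hQR⟩ := hba.exists_right hh hb
  have := hh.eq_of_hasPos ha hR (by omega) (by omega)
  rcases hPQ with hPQ | ⟨rfl, h1⟩
  · omega
  rcases hQR with hQR | ⟨rfl, h2⟩
  · omega
  exact hh.not_tieBefore_symm hG ha hb h1 h2

theorem not_holeBefore_cycle (hh : G.IsTightHole k h) (hG : G.IsClawTentNetFree) {a b c : V}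
    (hab : G.HoleBefore k h a b) (hbc : G.HoleBefore k h b c) : ¬ G.HoleBefore k h c a := by
  have hk := hh.six_le
  intro hca
  obtain ⟨-, P, Q, ha, hb, hPQ⟩ := hab
  obtain ⟨R, hc, hQR⟩ := hbc.exists_right hh hb
  obtain ⟨S, ha', hRS⟩ := hca.exists_right hh hc
  have := hh.eq_of_hasPos ha ha' (by omega) (by omega)
  rcases hPQ with hPQ | ⟨rfl, h1⟩
  · omega
  rcases hQR with hQR | ⟨rfl, h2⟩
  · omega
  rcases hRS with hRS | ⟨rfl, h3⟩
  · omega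
  exact hh.not_tieBefore_cycle hG ha hb hc h1 h2 h3

theorem adj_of_holeBefore_left (hh : G.IsTightHole k h) (hG : G.IsClawTentNetFree) {a b c : V}
    (hba : G.HoleBefore k h b a) (hbc : G.HoleBefore k h b c) (hne : a ≠ c) : G.Adj a c := by
  have hk := hh.six_le
  by_contra hac
  obtain ⟨P, hb⟩ : ∃ P, G.HasPos k h b P := ⟨_, hba.2.choose_spec.choose_spec.1⟩
  obtain ⟨Q, ha, hQ⟩ := hba.exists_right hh hb
  obtain ⟨R, hc, hR⟩ := hbc.exists_right hh hb
  wlog hQR : Q ≤ R generalizing a c Q R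
  · exact this hbc hba hne.symm (fun h' => hac h'.symm) R hc hR Q ha hQ (by omega)
  have h1 : Q + 2 ≤ R := by
    by_contra h'
    exact hac (hh.adj_of_hasPos_near hG ha hc (by omega) (by omega) hne)
  rcases hQ with hQ | ⟨rfl, hQ⟩
  · obtain rfl : Q = P + 1 := by omega
    obtain rfl : R = P + 3 := by omega
    exact hac (hh.adj_of_one_three hG hb ha hc hba.1 hbc.1)
  · exact hh.not_tieBefore_symm hG hb ha hQ (Or.inl ⟨c, R, hc, by omega, by omega, hbc.1, hac⟩)

theorem adj_of_holeBefore_right (hh : G.IsTightHole k h) (hG : G.IsClawTentNetFree) {a b c : V}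
    (hab : G.HoleBefore k h a b) (hcb : G.HoleBefore k h c b) (hne : a ≠ c) : G.Adj a c :=
  hh.reverse.adj_of_holeBefore_left hG hab.reverse hcb.reverse hne

theorem not_twin_of_holeBefore (hh : G.IsTightHole k h) {a b : V}
    (hab : G.HoleBefore k h a b) : ¬ G.Twin a b := by
  have hk := hh.six_le
  intro ht
  obtain ⟨hadj, P, Q, ha, hb, hPQ⟩ := hab
  have := hh.eq_of_hasPos (ht.hasPos ha) hb (by omega) (by omega)
  rcases hPQ with hPQ | ⟨rfl, ⟨x, Q, hx, x1, x2, x3, x4⟩ | ⟨x, Q, hx, x1, x2, x3, x4⟩⟩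
  · omega
  · exact ((ht x).2 (Or.inr x3)).elim
      (hh.ne_of_hasPos ha hx (by omega) (by omega) (by omega)) x4
  · exact ((ht x).1 (Or.inr x3)).elim
      (hh.ne_of_hasPos hb hx.of_reverse (by omega) (by omega) (by omega)) x4

theorem holeBefore_twin_left (hh : G.IsTightHole k h) {a b c : V} (ht : G.Twin a b)
    (hac : G.HoleBefore k h a c) : G.HoleBefore k h b c := by
  have hk := hh.six_le
  have hbc : G.Adj b c := ((ht c).1 (Or.inr hac.1)).resolve_left
    fun h' => hh.not_twin_of_holeBefore hac (h' ▸ ht)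
  obtain ⟨hadj, P, Q, ha, hc, hPQ⟩ := hac
  have hb := ht.hasPos ha
  refine ⟨hbc, P, Q, hb, hc, hPQ.imp_right fun ⟨h1, h2⟩ => ⟨h1, ?_⟩⟩
  rcases h2 with ⟨x, Q, hx, x1, x2, x3, x4⟩ | ⟨x, Q, hx, x1, x2, x3, x4⟩
  · exact Or.inl ⟨x, Q, hx, x1, x2, x3, fun h' => ((ht x).2 (Or.inr h')).elim
      (hh.ne_of_hasPos ha hx (by omega) (by omega) (by omega)) x4⟩
  · exact Or.inr ⟨x, Q, hx, x1, x2, ((ht x).1 (Or.inr x3)).resolve_left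
      (hh.ne_of_hasPos hb hx.of_reverse (by omega) (by omega) (by omega)), x4⟩

theorem holeBefore_twin_right (hh : G.IsTightHole k h) {a b c : V} (ht : G.Twin a b)
    (hca : G.HoleBefore k h c a) : G.HoleBefore k h c b :=
  (hh.reverse.holeBefore_twin_left ht hca.reverse).of_reverse

end IsTightHole

end SimpleGraph

namespace SimpleGraph

variable {V : Type*} {G : SimpleGraph V}

theorem twin_isolate_iff {X : Set V} (hX : ∀ {a b}, G.Adj a b → a ∈ X → b ∈ X) {a b : V}
    (ha : a ∉ X) (hb : b ∉ X) : (G.isolate X).Twin a b ↔ G.Twin a b := by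
  have key : ∀ {a}, a ∉ X → ∀ c, (G.isolate X).Adj a c ↔ G.Adj a c := fun ha c =>
    ⟨fun h => h.1, fun h => ⟨h, ha, fun hc => ha (hX h.symm hc)⟩⟩
  simp only [Twin, key ha, key hb]

/-- Local orientations can be combined along a union of connected components. -/
theorem IsLocalOrientation.of_isolate {X : Set V} {D₁ D₂ : V → V → Prop}
    (hX : ∀ {a b}, G.Adj a b → a ∈ X → b ∈ X) (h₁ : (G.isolate Xᶜ).IsLocalOrientation D₁)
    (h₂ : (G.isolate X).IsLocalOrientation D₂) :
    G.IsLocalOrientation (fun a b => D₁ a b ∨ D₂ a b) := by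
  have hX' : ∀ {a b}, G.Adj a b → a ∈ Xᶜ → b ∈ Xᶜ := fun h ha hb => ha (hX h.symm hb)
  have adj₁ : ∀ {a b}, D₁ a b → G.Adj a b ∧ a ∈ X ∧ b ∈ X := fun h => by
    simpa [SimpleGraph.isolate] using h₁.adj h
  have adj₂ : ∀ {a b}, D₂ a b → G.Adj a b ∧ a ∉ X ∧ b ∉ X := fun h => h₂.adj h
  have tw₁ : ∀ {a b}, a ∈ X → b ∈ X → ((G.isolate Xᶜ).Twin a b ↔ G.Twin a b) := fun ha hb =>
    twin_isolate_iff hX' (not_not.2 ha) (not_not.2 hb)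
  have tw₂ : ∀ {a b}, a ∉ X → b ∉ X → ((G.isolate X).Twin a b ↔ G.Twin a b) := fun ha hb =>
    twin_isolate_iff hX ha hb
  have tw : ∀ {a b}, G.Twin a b → (a ∈ X ↔ b ∈ X) := fun {a b} h => by
    rcases h.eq_or_adj with rfl | h'
    · rfl
    · exact ⟨hX h', hX h'.symm⟩
  refine ⟨fun h => h.elim (fun h => (adj₁ h).1) fun h => (adj₂ h).1, ?_, ?_, ?_, ?_, ?_, ?_, ?_⟩
  · rintro a b (h | h) ht
    · exact h₁.not_twin h ((tw₁ (adj₁ h).2.1 (adj₁ h).2.2).2 ht)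
    · exact h₂.not_twin h ((tw₂ (adj₂ h).2.1 (adj₂ h).2.2).2 ht)
  · intro a b h ht
    by_cases ha : a ∈ X
    · have hb := hX h ha
      exact (h₁.total ⟨h, not_not.2 ha, not_not.2 hb⟩ fun h' => ht ((tw₁ ha hb).1 h')).imp
        Or.inl Or.inl
    · have hb := hX' h ha
      exact (h₂.total ⟨h, ha, hb⟩ fun h' => ht ((tw₂ ha hb).1 h')).imp Or.inr Or.inr
  · rintro a b (h | h) (h' | h')
    · exact h₁.asymm h h'
    · exact (adj₂ h').2.1 (adj₁ h).2.2
    · exact (adj₂ h).2.1 (adj₁ h').2.2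
    · exact h₂.asymm h h'
  · intro a b c hab hbc hac hne
    by_cases ha : a ∈ X
    · have hb := hX hab ha
      have hc := hX hbc hb
      have n₁ : ¬ D₂ a b := fun h => (adj₂ h).2.1 ha
      have n₂ : ¬ D₂ b c := fun h => (adj₂ h).2.1 hb
      simpa only [n₁, n₂, or_false] using h₁.path (a := a) (b := b) (c := c)
        ⟨hab, not_not.2 ha, not_not.2 hb⟩ ⟨hbc, not_not.2 hb, not_not.2 hc⟩ (fun h => hac h.1) hne
    · have hb := hX' hab ha
      have hc := hX' hbc hb
      have n₁ : ¬ D₁ a b := fun h => ha (adj₁ h).2.1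
      have n₂ : ¬ D₁ b c := fun h => hb (adj₁ h).2.1
      simpa only [n₁, n₂, false_or] using h₂.path (a := a) (b := b) (c := c)
        ⟨hab, ha, hb⟩ ⟨hbc, hb, hc⟩ (fun h => hac h.1) hne
  · rintro a b c (h | h) (h' | h') (h'' | h'')
    · exact h₁.triangle h h' h''
    · exact (adj₂ h'').2.2 (adj₁ h).2.1
    · exact (adj₂ h').2.1 (adj₁ h).2.2
    · exact (adj₂ h').2.1 (adj₁ h).2.2
    · exact (adj₂ h).2.2 (adj₁ h').2.1
    · exact (adj₂ h).2.2 (adj₁ h').2.1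
    · exact (adj₂ h).2.1 (adj₁ h'').2.2
    · exact h₂.triangle h h' h''
  · rintro a b c ht (h | h)
    · have ha := (adj₁ h).2.1
      exact Or.inl (h₁.twin_left ((tw₁ ha ((tw ht).1 ha)).2 ht) h)
    · have ha := (adj₂ h).2.1
      exact Or.inr (h₂.twin_left ((tw₂ ha fun hb => ha ((tw ht).2 hb)).2 ht) h)
  · rintro a b c ht (h | h)
    · have ha := (adj₁ h).2.2
      exact Or.inl (h₁.twin_right ((tw₁ ha ((tw ht).1 ha)).2 ht) h)
    · have ha := (adj₂ h).2.2
      exact Or.inr (h₂.twin_right ((tw₂ ha fun hb => ha ((tw ht).2 hb)).2 ht) h)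

theorem IsTightHole.isLocalOrientation {k : ℤ} {h : ℤ → V} (hh : G.IsTightHole k h)
    (hG : G.IsClawTentNetFree) :
    (G.isolate {v | ∃ P, G.HasPos k h v P}ᶜ).IsLocalOrientation (G.HoleBefore k h) := by
  set X := {v | ∃ P, G.HasPos k h v P}
  have hX : ∀ {a b}, G.Adj a b → a ∈ Xᶜ → b ∈ Xᶜ := fun hab ha ⟨_, hb⟩ =>
    ha (hh.exists_hasPos_of_adj hG hb hab.symm)
  have mem : ∀ {a b}, G.HoleBefore k h a b → a ∉ Xᶜ ∧ b ∉ Xᶜ := fun ⟨_, P, Q, hP, hQ, _⟩ =>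
    ⟨not_not.2 ⟨P, hP⟩, not_not.2 ⟨Q, hQ⟩⟩
  have htw : ∀ {a b}, a ∉ Xᶜ → (G.isolate Xᶜ).Twin a b → G.Twin a b := fun {a b} ha ht => by
    have hb : b ∉ Xᶜ := by
      rcases ht.eq_or_adj with rfl | h'
      · exact ha
      · exact h'.2.2
    exact (twin_isolate_iff hX ha hb).1 ht
  refine ⟨fun hd => ⟨hd.1, mem hd⟩, fun hd ht =>
    hh.not_twin_of_holeBefore hd (htw (mem hd).1 ht), ?_, hh.not_holeBefore_symm hG, ?_,
    hh.not_holeBefore_cycle hG, fun {a b c} ht hd => hh.holeBefore_twin_left (htw (mem hd).1 ht) hd,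
    fun {a b c} ht hd => hh.holeBefore_twin_right (htw (mem hd).2 ht) hd⟩
  · rintro a b ⟨hab, ha, hb⟩ ht
    obtain ⟨P, hP⟩ := not_not.1 ha
    exact hh.holeBefore_total hG hP hab fun h' => ht ((twin_isolate_iff hX ha hb).2 h')
  · rintro a b c ⟨hab, ha, hb⟩ ⟨hbc, -, hc⟩ hac hne
    have hac' : ¬ G.Adj a c := fun h' => hac ⟨h', ha, hc⟩
    obtain ⟨P, hP⟩ := not_not.1 ha
    obtain ⟨Q, hQ⟩ := not_not.1 hb
    have t₁ := hh.holeBefore_total hG hP hab fun ht =>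
      ((ht c).2 (Or.inr hbc)).elim hne hac'
    have t₂ := hh.holeBefore_total hG hQ hbc fun ht =>
      ((ht a).1 (Or.inr hab.symm)).elim hne.symm fun h' => hac' h'.symm
    exact ⟨fun h₁ => t₂.resolve_right fun h₂ => hac' (hh.adj_of_holeBefore_right hG h₁ h₂ hne),
      fun h₂ => t₁.resolve_right fun h₁ => hac' (hh.adj_of_holeBefore_left hG h₁ h₂ hne)⟩

theorem ncard_nonisolated_isolate_lt [Finite V] {X : Set V} {v w : V} (hv : v ∈ X)
    (hvw : G.Adj v w) : {a | ∃ b, (G.isolate X).Adj a b}.ncard < {a | ∃ b, G.Adj a b}.ncard := by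
  refine Set.ncard_lt_ncard ⟨fun a ⟨b, hab⟩ => ⟨b, hab.1⟩, fun hsub => ?_⟩ (Set.toFinite _)
  obtain ⟨b, hb⟩ := hsub (show v ∈ {a | ∃ b, G.Adj a b} from ⟨w, hvw⟩)
  exact hb.2.1 hv

theorem IsClawTentNetFree.exists_isLocalOrientation [Finite V] (hG : G.IsClawTentNetFree) :
    ∃ D, G.IsLocalOrientation D := by
  obtain ⟨n, hn⟩ : ∃ n, {a | ∃ b, G.Adj a b}.ncard = n := ⟨_, rfl⟩
  induction n using Nat.strong_induction_on generalizing G with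
  | _ n ih =>
  subst hn
  by_cases hP3 : ∃ u v w, G.Adj u v ∧ G.Adj v w ∧ ¬ G.Adj w u ∧ w ≠ u
  · obtain ⟨u, v, w, huv, hvw, hwu, hne⟩ := hP3
    by_cases hend : ∃ x y, G.Adj x y ∧ G.IsEnd x
    · obtain ⟨x, y, hxy, hx⟩ := hend
      obtain ⟨D, hD⟩ := ih _ (ncard_nonisolated_isolate_lt (Set.mem_singleton x) hxy)
        (hG.isolate _) rfl
      exact hx.exists_isLocalOrientation hG hD
    · push Not at hend
      have hex := hG.exists_isInducedCycle hend huv hvw hwu hne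
      classical
      obtain ⟨g, hg⟩ := Nat.find_spec hex
      have hmin : ∀ m g, m < Nat.find hex → ¬ G.IsInducedCycle m g := fun m g hm hg' =>
        Nat.find_min hex hm ⟨g, hg'⟩
      generalize Nat.find hex = N at hg hmin
      have hN : 6 ≤ N := by
        have := hg.four_le
        have e : ∀ i j, i < j → j < N → _ := fun i j h1 h2 => hg.adj_iff h1 h2
        by_contra hlt
        obtain rfl | rfl : N = 4 ∨ N = 5 := by omega
        · exact hG.cycle_four (g 0) (g 1) (g 2) (g 3) (by simp [e]) (by simp [e]) (by simp [e])
            (G.symm.1 _ _ (by simp [e])) (hg.ne (by simp) (by simp)) (hg.ne (by simp) (by simp))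
            (by simp [e]) (by simp [e])
        · exact hG.cycle_five (g 0) (g 1) (g 2) (g 3) (g 4) (by simp [e]) (by simp [e])
            (by simp [e]) (by simp [e]) (G.symm.1 _ _ (by simp [e])) (by simp [e]) (by simp [e])
            (by simp [e]) (by simp [e]) (by simp [e])
      have hh := hg.isTightHole hN hmin
      generalize (fun j : ℤ => g (j % (N : ℤ)).toNat) = h at hh
      obtain ⟨D, hD⟩ := ih _ (ncard_nonisolated_isolate_lt
        (X := {v | ∃ P, G.HasPos N h v P}) ⟨_, hh.hasPos_self 0⟩ (hh.adj_succ 0))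
        (hG.isolate _) rfl
      exact ⟨_, (hh.isLocalOrientation hG).of_isolate
        (fun hab ha => hh.exists_hasPos_of_adj hG ha.choose_spec hab) hD⟩
  · push Not at hP3
    refine ⟨fun _ _ => False, ⟨False.elim, False.elim, ?_, False.elim, ?_, False.elim, fun _ h => h,
      fun _ h => h⟩⟩
    · intro a b hab ht
      refine (ht fun c => ⟨?_, ?_⟩).elim
      · rintro (rfl | h')
        · exact Or.inr hab.symm
        · by_contra! hc
          exact hc.1 (hP3 c a b h'.symm hab fun h'' => hc.2 h'')
      · rintro (rfl | h')
        · exact Or.inr hab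
        · by_contra! hc
          exact hc.1 (hP3 c b a h'.symm hab.symm fun h'' => hc.2 h'')
    · exact fun hab hbc hac hne => (hne (hP3 _ _ _ hab hbc fun h => hac h.symm).symm).elim

end SimpleGraph

namespace SimpleGraph

variable {V : Type*} {G : SimpleGraph V}

/-- An orientation of all edges in which out- and in-neighbourhoods are cliques and there is no
directed triangle. -/
structure IsRoundOrientation (G : SimpleGraph V) (R : V → V → Prop) : Prop where
  adj : ∀ {a b}, R a b → G.Adj a b
  total : ∀ {a b}, G.Adj a b → R a b ∨ R b a
  asymm : ∀ {a b}, R a b → ¬ R b a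
  out_clique : ∀ {v a b}, R v a → R v b → a ≠ b → G.Adj a b
  in_clique : ∀ {v a b}, R a v → R b v → a ≠ b → G.Adj a b
  triangle : ∀ {a b c}, R a b → R b c → ¬ R c a

theorem IsLocalOrientation.isRoundOrientation {D : V → V → Prop} (hD : G.IsLocalOrientation D)
    {e : V → ℕ} (he : Function.Injective e) :
    G.IsRoundOrientation (fun a b => D a b ∨ (G.Adj a b ∧ G.Twin a b ∧ e a < e b)) where
  adj h := h.elim hD.adj fun h => h.1
  total {a b} hab := by
    by_cases ht : G.Twin a b
    · rcases lt_trichotomy (e a) (e b) with h | h | h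
      · exact Or.inl (Or.inr ⟨hab, ht, h⟩)
      · exact (hab.ne (he h)).elim
      · exact Or.inr (Or.inr ⟨hab.symm, ht.symm, h⟩)
    · exact (hD.total hab ht).imp Or.inl Or.inl
  asymm := by
    rintro a b (h | ⟨h, ht, hlt⟩) (h' | ⟨h', ht', hlt'⟩)
    · exact hD.asymm h h'
    · exact hD.not_twin h ht'.symm
    · exact hD.not_twin h' ht.symm
    · omega
  out_clique := by
    intro v a b hva hvb hne
    by_contra hab
    have ha : G.Adj v a := hva.elim hD.adj fun h => h.1
    have hb : G.Adj v b := hvb.elim hD.adj fun h => h.1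
    have hva' := hva.resolve_right fun h => hab (h.2.1.adj_of_adj hb hne)
    have hvb' := hvb.resolve_right fun h => hab (h.2.1.adj_of_adj ha hne.symm).symm
    exact hD.asymm hva' ((hD.path ha.symm hb hab hne).2 hvb')
  in_clique := by
    intro v a b hav hbv hne
    by_contra hab
    have ha : G.Adj a v := hav.elim hD.adj fun h => h.1
    have hb : G.Adj b v := hbv.elim hD.adj fun h => h.1
    have hav' := hav.resolve_right fun h => hab (h.2.1.symm.adj_of_adj hb.symm hne)
    have hbv' := hbv.resolve_right fun h => hab (h.2.1.symm.adj_of_adj ha.symm hne.symm).symm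
    exact hD.asymm hbv' ((hD.path ha hb.symm hab hne).1 hav')
  triangle := by
    rintro a b c (h₁ | ⟨-, t₁, l₁⟩) (h₂ | ⟨-, t₂, l₂⟩) (h₃ | ⟨-, t₃, l₃⟩)
    · exact hD.triangle h₁ h₂ h₃
    · exact hD.asymm h₂ (hD.twin_left t₃.symm h₁)
    · exact hD.asymm h₁ (hD.twin_left t₂.symm h₃)
    · exact hD.not_twin (hD.twin_left t₃.symm h₁) t₂.symm
    · exact hD.asymm h₃ (hD.twin_left t₁.symm h₂)
    · exact hD.not_twin (hD.twin_left t₁.symm h₂) t₃.symm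
    · exact hD.not_twin (hD.twin_left t₂.symm h₃) t₁.symm
    · omega

namespace IsRoundOrientation

variable {R : V → V → Prop}

protected theorem swap (hR : G.IsRoundOrientation R) :
    G.IsRoundOrientation (Function.swap R) where
  adj h := (hR.adj h).symm
  total h := (hR.total h).symm
  asymm h := hR.asymm h
  out_clique := hR.in_clique
  in_clique := hR.out_clique
  triangle h₁ h₂ h₃ := hR.triangle h₂ h₁ h₃

theorem irrefl (hR : G.IsRoundOrientation R) (v : V) : ¬ R v v := fun h => hR.asymm h h

theorem exists_source [Finite V] (hR : G.IsRoundOrientation R) {C : Set V} (hC : C.Nonempty)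
    (hcl : ∀ a ∈ C, ∀ b ∈ C, a ≠ b → G.Adj a b) : ∃ a ∈ C, ∀ x ∈ C, x = a ∨ R a x := by
  let S : V → V → Prop := fun a b => a ∈ C ∧ b ∈ C ∧ R a b
  have : IsTrans V S := ⟨fun a b c hab hbc => ⟨hab.1, hbc.2.1, by
    have hne : a ≠ c := fun h => hR.asymm hab.2.2 (h ▸ hbc.2.2)
    exact (hR.total (hcl a hab.1 c hbc.2.1 hne)).resolve_right
      (hR.triangle hab.2.2 hbc.2.2)⟩⟩
  have : Std.Irrefl S := ⟨fun a h => hR.irrefl a h.2.2⟩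
  obtain ⟨a, ha, hmin⟩ := (Finite.wellFounded_of_trans_of_irrefl S).has_min C hC
  refine ⟨a, ha, fun x hx => or_iff_not_imp_left.2 fun hne => ?_⟩
  exact (hR.total (hcl x hx a ha hne)).resolve_left fun h => hmin x hx ⟨hx, ha, h⟩

theorem exists_perm [Finite V] (hR : G.IsRoundOrientation R) :
    ∃ σ : Equiv.Perm V, ∀ v x, R v x → R v (σ v) ∧ (x = σ v ∨ R (σ v) x) := by
  classical
  have := Fintype.ofFinite V
  have hs : ∀ v, ∃ a, ∀ x, R v x → R v a ∧ (x = a ∨ R a x) := by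
    intro v
    by_cases hv : ∃ x, R v x
    · obtain ⟨a, ha, hmin⟩ := hR.exists_source (C := {x | R v x}) hv
        fun a ha b hb => hR.out_clique ha hb
      exact ⟨a, fun x hx => ⟨ha, hmin x hx⟩⟩
    · exact ⟨v, fun x hx => (hv ⟨x, hx⟩).elim⟩
  choose s hs using hs
  have hinj : Set.InjOn s {v | ∃ x, R v x} := by
    rintro v ⟨x, hx⟩ w ⟨y, hy⟩ hvw
    by_contra hne
    have hv := (hs v x hx).1
    have hw := (hs w y hy).1
    rcases hR.total (hR.in_clique hv (hvw ▸ hw) hne) with h | h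
    · rcases (hs v w h).2 with h' | h'
      · rw [hvw] at h'
        rw [← h'] at hw
        exact hR.irrefl _ hw
      · exact hR.asymm h' (hvw ▸ hw)
    · rcases (hs w v h).2 with h' | h'
      · rw [← hvw] at h'
        rw [← h'] at hv
        exact hR.irrefl _ hv
      · exact hR.asymm h' (hvw ▸ hv)
  obtain ⟨g, hg⟩ := Set.MapsTo.exists_equiv_extend_of_card_eq (t := Finset.univ)
    (by simp) (fun _ _ => by simp) hinj
  let σ : Equiv.Perm V := g.trans (Equiv.subtypeUnivEquiv (by simp))
  have hσ : ∀ v, (∃ x, R v x) → σ v = s v := fun v hv => hg v hv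
  refine ⟨σ, fun v x hx => ?_⟩
  rw [hσ v ⟨x, hx⟩]
  exact hs v x hx

theorem exists_pow_eq [Finite V] (hR : G.IsRoundOrientation R) {σ : Equiv.Perm V}
    (hσ : ∀ v x, R v x → R v (σ v) ∧ (x = σ v ∨ R (σ v) x)) {v x : V} (hvx : R v x) :
    ∃ m : ℕ, 1 ≤ m ∧ (σ ^ m) v = x ∧
      ∀ j, 1 ≤ j → j < m → R v ((σ ^ j) v) ∧ R ((σ ^ j) v) x := by
  obtain ⟨N, hN⟩ : ∃ N, {y | R v y ∧ R y x}.ncard = N := ⟨_, rfl⟩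
  induction N using Nat.strong_induction_on generalizing v with
  | _ N ih =>
  subst hN
  obtain ⟨h1, rfl | h2⟩ := hσ v x hvx
  · exact ⟨1, le_rfl, by simp, fun j h2 h3 => by omega⟩
  have key : ∀ y, R (σ v) y → R y x → R v y := by
    intro y h3 h4
    have hne : v ≠ y := fun h => hR.asymm h1 (h ▸ h3)
    exact (hR.total (hR.in_clique hvx h4 hne)).resolve_right (hR.triangle h1 h3)
  obtain ⟨m, hm, hmx, hj⟩ := ih _ (Set.ncard_lt_ncard
    ⟨fun y hy => ⟨key y hy.1 hy.2, hy.2⟩, fun hsub => hR.irrefl _ (hsub ⟨h1, h2⟩).1⟩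
    (Set.toFinite _)) h2 rfl
  refine ⟨m + 1, by omega, by simpa [pow_succ] using hmx, fun j hj1 hj2 => ?_⟩
  obtain rfl | ⟨i, rfl⟩ : j = 1 ∨ ∃ i, j = i + 1 + 1 := by
    rcases j with _ | _ | i
    · omega
    · exact Or.inl rfl
    · exact Or.inr ⟨i, rfl⟩
  · simpa using ⟨h1, h2⟩
  · have h3 := hj (i + 1) (by omega) (by omega)
    rw [pow_succ, Equiv.Perm.mul_apply]
    exact ⟨key _ h3.1 h3.2, h3.2⟩

end IsRoundOrientation

/-- A periodic enumeration `h` of the vertices, of period `n`, such that the out-neighbours of each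
vertex `v` are the `d v` vertices that follow it. -/
structure IsCircularEnumeration (R : V → V → Prop) (n : ℤ) (h : ℤ → V) (d : V → ℤ) : Prop where
  pos : 0 < n
  surjective : Function.Surjective h
  eq_iff : ∀ i j, h i = h j ↔ n ∣ i - j
  nonneg : ∀ v, 0 ≤ d v
  lt : ∀ v, d v < n
  le_succ : ∀ i, d (h i) ≤ 1 + d (h (i + 1))
  out_iff : ∀ i x, R (h i) x ↔ ∃ m, 1 ≤ m ∧ m ≤ d (h i) ∧ h (i + m) = x

theorem IsRoundOrientation.exists_isCircularEnumeration [Finite V] {R : V → V → Prop}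
    (hR : G.IsRoundOrientation R) (hG : G.Connected) :
    ∃ n h d, IsCircularEnumeration R n h d := by
  classical
  have := Fintype.ofFinite V
  obtain ⟨σ, hσ⟩ := hR.exists_perm
  obtain ⟨v₀⟩ := hG.nonempty
  have hstep : ∀ {a b}, G.Adj a b → σ.SameCycle a b := by
    intro a b hab
    rcases hR.total hab with h | h
    · obtain ⟨m, -, hm, -⟩ := hR.exists_pow_eq hσ h
      exact ⟨m, by simpa using hm⟩
    · obtain ⟨m, -, hm, -⟩ := hR.exists_pow_eq hσ h
      exact Equiv.Perm.SameCycle.symm ⟨m, by simpa using hm⟩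
  have hcyc : σ.IsCycleOn ((Finset.univ : Finset V) : Set V) := by
    refine ⟨by simp, fun a _ b _ => ?_⟩
    obtain ⟨w⟩ := hG.preconnected a b
    induction w with
    | nil => exact Equiv.Perm.SameCycle.refl _ _
    | cons hadj _ ih => exact (hstep hadj).trans (ih (by simp) (by simp))
  have hd : ∀ v, ∃ m, ¬ R v ((σ ^ (m + 1)) v) ∧ m < Fintype.card V ∧
      ∀ j, 1 ≤ j → j ≤ m → R v ((σ ^ j) v) := by
    intro v
    have hcard : 0 < Fintype.card V := Fintype.card_pos_iff.2 ⟨v⟩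
    have hlast : ¬ R v ((σ ^ (Fintype.card V - 1 + 1)) v) := by
      rw [Nat.sub_add_cancel hcard, ← Finset.card_univ, hcyc.pow_card_apply (by simp)]
      exact hR.irrefl v
    have hex : ∃ m, ¬ R v ((σ ^ (m + 1)) v) := ⟨_, hlast⟩
    refine ⟨Nat.find hex, Nat.find_spec hex, ?_, fun j hj1 hj2 => ?_⟩
    · have := Nat.find_min' hex hlast
      omega
    · have := Nat.find_min hex (show j - 1 < Nat.find hex by omega)
      rw [Nat.sub_add_cancel hj1] at this
      exact not_not.1 this
  choose d hd1 hd2 hd3 using hd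
  have hout : ∀ v x, R v x ↔ ∃ m, 1 ≤ m ∧ m ≤ d v ∧ (σ ^ m) v = x := by
    intro v x
    constructor
    · intro hx
      obtain ⟨m, hm, rfl, hj⟩ := hR.exists_pow_eq hσ hx
      refine ⟨m, hm, ?_, rfl⟩
      by_contra hlt
      rcases (by omega : d v + 1 < m ∨ d v + 1 = m) with h | h
      · exact hd1 v (hj _ (by omega) h).1
      · exact hd1 v (h ▸ hx)
    · rintro ⟨m, hm1, hm2, rfl⟩
      exact hd3 v m hm1 hm2
  refine ⟨Fintype.card V, fun i => (σ ^ i) v₀, fun v => d v, ?_, ?_, ?_, ?_, ?_, ?_, ?_⟩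
  · exact_mod_cast Fintype.card_pos_iff.2 ⟨v₀⟩
  · intro x
    obtain ⟨m, -, hm⟩ := hcyc.exists_pow_eq (a := v₀) (b := x) (by simp) (by simp)
    exact ⟨m, by simpa using hm⟩
  · intro i j
    rw [hcyc.zpow_apply_eq_zpow_apply (by simp), Finset.card_univ, Int.modEq_comm,
      Int.modEq_iff_dvd]
  · intro v
    positivity
  · exact fun v => by exact_mod_cast hd2 v
  · intro i
    have hv : (σ ^ (i + 1)) v₀ = σ ((σ ^ i) v₀) := by
      rw [add_comm, zpow_add, zpow_one, Equiv.Perm.mul_apply]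
    simp only [hv]
    generalize (σ ^ i) v₀ = v
    by_contra hlt
    have h1 := hd1 (σ v)
    have h2 := hd3 v (d (σ v) + 2) (by omega) (by omega)
    rw [← Equiv.Perm.mul_apply (σ ^ (d (σ v) + 1)), ← pow_succ] at h1
    rcases (hσ v _ h2).2 with h3 | h3
    · refine hR.irrefl v ?_
      have h4 := hd3 v (d (σ v) + 1) (by omega) (by omega)
      rw [pow_succ', Equiv.Perm.mul_apply, σ.injective.eq_iff] at h3
      rwa [h3] at h4
    · exact h1 h3
  · intro i x
    simp only [hout]
    constructor
    · rintro ⟨m, h1, h2, h3⟩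
      exact ⟨m, by omega, by omega, by
        rw [add_comm, zpow_add, Equiv.Perm.mul_apply]; simpa using h3⟩
    · rintro ⟨m, h1, h2, h3⟩
      lift m to ℕ using by omega
      exact ⟨m, by omega, by omega, by
        rw [add_comm, zpow_add, Equiv.Perm.mul_apply] at h3; simpa using h3⟩

end SimpleGraph

namespace SimpleGraph

variable {V : Type*} {G : SimpleGraph V} {R : V → V → Prop} {n : ℤ} {h : ℤ → V} {d : V → ℤ}

namespace IsCircularEnumeration

theorem periodic (hc : IsCircularEnumeration R n h d) (i m : ℤ) : h (i + n * m) = h i :=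
  (hc.eq_iff _ _).2 ⟨m, by ring⟩

theorem le_add (hc : IsCircularEnumeration R n h d) (i : ℤ) (m : ℕ) :
    d (h i) ≤ m + d (h (i + m)) := by
  induction m with
  | zero => simp
  | succ m ih =>
    have := hc.le_succ (i + m)
    push_cast
    rw [← add_assoc]
    omega

/-- A position of the vertex `v` in the enumeration. -/
noncomputable def index (hc : IsCircularEnumeration R n h d) : V → ℤ :=
  Function.surjInv hc.surjective

theorem apply_index (hc : IsCircularEnumeration R n h d) (v : V) : h (hc.index v) = v :=
  Function.surjInv_eq hc.surjective v

/-- The arc of `v` starts at `(n + 1) * index v` and has length `n * (d v + 1)`, on a circle of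
length `n * (n + 1)`. -/
noncomputable def model (hc : IsCircularEnumeration R n h d) : PreArcModel V where
  L := (n * (n + 1) : ℤ)
  L_pos := by
    have := hc.pos
    exact_mod_cast (by positivity : 0 < n * (n + 1))
  src v := ((n + 1) * hc.index v : ℤ)
  len v := (n * (d v + 1) : ℤ)
  len_pos v := by
    have := hc.pos
    have := hc.nonneg v
    exact_mod_cast (by positivity : 0 < n * (d v + 1))
  len_lt v := by
    have := hc.pos
    have := hc.lt v
    exact_mod_cast (by nlinarith : n * (d v + 1) < n * (n + 1))

theorem coe_eq_coe_iff {L : ℝ} {x y : ℝ} :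
    (x : AddCircle L) = y ↔ ∃ t : ℤ, x + t * L = y := by
  rw [eq_comm, ← sub_eq_zero, ← AddCircle.coe_sub, AddCircle.coe_eq_zero_iff]
  simp only [zsmul_eq_mul, eq_sub_iff_add_eq']

theorem coe_mem_arc_iff (hc : IsCircularEnumeration R n h d) {a : ℤ} {v : V} :
    (((a : ℤ) : ℝ) : AddCircle hc.model.L) ∈ hc.model.arc v ↔
      ∃ t : ℤ, (n + 1) * hc.index v ≤ a + t * (n * (n + 1)) ∧
        a + t * (n * (n + 1)) ≤ (n + 1) * hc.index v + n * (d v + 1) := by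
  simp only [PreArcModel.arc, Set.mem_image, Set.mem_Icc]
  constructor
  · rintro ⟨x, ⟨hx1, hx2⟩, hx⟩
    obtain ⟨t, rfl⟩ := coe_eq_coe_iff.1 hx.symm
    simp only [model] at hx1 hx2
    exact ⟨t, by exact_mod_cast hx1, by exact_mod_cast hx2⟩
  · rintro ⟨t, h1, h2⟩
    refine ⟨((a + t * (n * (n + 1)) : ℤ) : ℝ), ⟨?_, ?_⟩, ?_⟩
    · simp only [model]
      exact_mod_cast h1
    · simp only [model]
      exact_mod_cast h2
    · refine (coe_eq_coe_iff.2 ⟨t, ?_⟩).symm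
      simp [model]

theorem rel_iff (hc : IsCircularEnumeration R n h d) {v u : V} :
    R v u ↔ ∃ m, 1 ≤ m ∧ m ≤ d v ∧ h (hc.index v + m) = u := by
  have := hc.out_iff (hc.index v) u
  rwa [hc.apply_index] at this

theorem ccp_mem_arc_iff (hc : IsCircularEnumeration R n h d) {u v : V} :
    hc.model.ccp u ∈ hc.model.arc v ↔ u = v ∨ R v u := by
  have hn := hc.pos
  have hd := hc.lt v
  have hd0 := hc.nonneg v
  have hmem : hc.model.ccp u ∈ hc.model.arc v ↔ _ := hc.coe_mem_arc_iff
  rw [hmem]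
  rw [hc.rel_iff]
  constructor
  · rintro ⟨t, h1, h2⟩
    have h3 : 0 ≤ hc.index u + n * t - hc.index v := by nlinarith
    have h4 : hc.index u + n * t - hc.index v ≤ d v := by
      by_contra! h5
      nlinarith
    have h5 : h (hc.index v + (hc.index u + n * t - hc.index v)) = u := by
      rw [add_sub_cancel, hc.periodic, hc.apply_index]
    by_cases h6 : hc.index u + n * t - hc.index v = 0
    · rw [h6, add_zero, hc.apply_index] at h5
      exact Or.inl h5.symm
    · exact Or.inr ⟨_, by omega, h4, h5⟩
  · rintro (rfl | ⟨m, h1, h2, h3⟩)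
    · exact ⟨0, by simp, by simp; positivity⟩
    · rw [← hc.apply_index u, hc.eq_iff] at h3
      obtain ⟨t, ht⟩ := h3
      refine ⟨t, ?_, ?_⟩ <;> nlinarith

theorem ccp_mem_arc_of_inter (hc : IsCircularEnumeration R n h d) {u v : V}
    (huv : (hc.model.arc u ∩ hc.model.arc v).Nonempty) :
    hc.model.ccp u ∈ hc.model.arc v ∨ hc.model.ccp v ∈ hc.model.arc u := by
  obtain ⟨_, ⟨x, ⟨hx1, hx2⟩, rfl⟩, y, ⟨hy1, hy2⟩, hxy⟩ := huv
  obtain ⟨t, rfl⟩ := coe_eq_coe_iff.1 hxy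
  rcases le_total (hc.model.src v + t * hc.model.L) (hc.model.src u) with h1 | h1
  · exact Or.inl ⟨hc.model.src u - t * hc.model.L, ⟨by linarith, by linarith⟩,
      coe_eq_coe_iff.2 ⟨t, by ring⟩⟩
  · exact Or.inr ⟨hc.model.src v + t * hc.model.L, ⟨by linarith, by linarith⟩,
      coe_eq_coe_iff.2 ⟨-t, by push_cast; ring⟩⟩

theorem inter_nonempty_iff (hc : IsCircularEnumeration R n h d) {u v : V} :
    (hc.model.arc u ∩ hc.model.arc v).Nonempty ↔ u = v ∨ R u v ∨ R v u := by
  have hself : ∀ v, hc.model.ccp v ∈ hc.model.arc v := fun v => hc.ccp_mem_arc_iff.2 (Or.inl rfl)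
  constructor
  · intro huv
    have := hc.ccp_mem_arc_of_inter huv
    rw [hc.ccp_mem_arc_iff, hc.ccp_mem_arc_iff] at this
    tauto
  · rintro (rfl | huv | huv)
    · exact ⟨_, hself u, hself u⟩
    · exact ⟨_, hc.ccp_mem_arc_iff.2 (Or.inr huv), hself v⟩
    · exact ⟨_, hself u, hc.ccp_mem_arc_iff.2 (Or.inr huv)⟩

theorem endpointsDistinct (hc : IsCircularEnumeration R n h d) : hc.model.EndpointsDistinct := by
  have hn := hc.pos
  have hinj : ∀ {u v : V} {t : ℤ}, hc.index u - hc.index v = n * t → u = v := by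
    intro u v t ht
    rw [← hc.apply_index u, ← hc.apply_index v, hc.eq_iff]
    exact ⟨t, ht⟩
  have hsrc : ∀ {u v}, hc.model.ccp u = hc.model.ccp v → u = v := by
    intro u v huv
    obtain ⟨t, ht⟩ := coe_eq_coe_iff.1 huv
    simp only [model] at ht
    have ht' : (n + 1) * hc.index u + t * (n * (n + 1)) = (n + 1) * hc.index v := by
      exact_mod_cast ht
    exact hinj (t := -t) (mul_left_cancel₀ (by omega : n + 1 ≠ 0) (by linarith))
  have hmix : ∀ u v, hc.model.ccp u ≠ hc.model.cp v := by
    intro u v huv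
    obtain ⟨t, ht⟩ := coe_eq_coe_iff.1 huv
    simp only [model] at ht
    have ht' : (n + 1) * hc.index u + t * (n * (n + 1)) =
        (n + 1) * hc.index v + n * (d v + 1) := by
      exact_mod_cast ht
    have hdvd : n + 1 ∣ d v + 1 :=
      ⟨d v + 1 - (hc.index u + t * n - hc.index v), by linarith⟩
    have := Int.le_of_dvd (by have := hc.nonneg v; omega) hdvd
    have := hc.lt v
    omega
  have hcp : ∀ {u v}, hc.model.cp u = hc.model.cp v → u = v := by
    intro u v huv
    obtain ⟨t, ht⟩ := coe_eq_coe_iff.1 huv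
    simp only [model] at ht
    have ht' : (n + 1) * hc.index u + n * (d u + 1) + t * (n * (n + 1)) =
        (n + 1) * hc.index v + n * (d v + 1) := by
      exact_mod_cast ht
    have hdvd : n + 1 ∣ d v - d u :=
      ⟨d v - d u - (hc.index u + t * n - hc.index v), by linarith⟩
    have h0 : d v - d u = 0 := by
      have h1 := hc.lt v
      have h2 := hc.lt u
      have h3 := hc.nonneg v
      have h4 := hc.nonneg u
      exact Int.eq_zero_of_abs_lt_dvd hdvd (abs_lt.2 (by omega))
    rw [show d v = d u by omega] at ht'
    exact hinj (t := -t) (mul_left_cancel₀ (by omega : n + 1 ≠ 0) (by linarith))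
  rintro ⟨u, _ | _⟩ ⟨v, _ | _⟩ huv
  · have := hsrc (u := u) (v := v) (by simpa using huv)
    rw [this]
  · exact (hmix u v (by simpa using huv)).elim
  · exact (hmix v u (by simpa using huv.symm)).elim
  · have := hcp (u := u) (v := v) (by simpa using huv)
    rw [this]

theorem proper (hc : IsCircularEnumeration R n h d) (hR : G.IsRoundOrientation R) :
    hc.model.Proper := by
  intro u v huv
  have hn := hc.pos
  have hne : u ≠ v := fun h' => huv.ne (h' ▸ rfl)
  have hvu : R v u := (hc.ccp_mem_arc_iff.1
    (huv.subset (hc.ccp_mem_arc_iff.2 (Or.inl rfl)))).resolve_left hne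
  have hcp : hc.model.cp u ∈ hc.model.arc v :=
    huv.subset ⟨_, ⟨le_add_of_nonneg_right (hc.model.len_pos u).le, le_rfl⟩, rfl⟩
  have hcp' : ((((n + 1) * hc.index u + n * (d u + 1) : ℤ) : ℝ) : AddCircle hc.model.L) ∈
      hc.model.arc v := by
    simpa [PreArcModel.cp, model] using hcp
  obtain ⟨t, h0, h1⟩ := hc.coe_mem_arc_iff.1 hcp'
  obtain ⟨m, hm1, hm2, hm⟩ := hc.rel_iff.1 hvu
  have hlt := hc.lt v
  have hdu : d v ≤ m + d u := by
    have := hc.le_add (hc.index v) m.toNat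
    rwa [Int.toNat_of_nonneg (by omega), hm, hc.apply_index] at this
  have hs := hm
  rw [← hc.apply_index u, hc.eq_iff] at hs
  obtain ⟨s, hs⟩ := hs
  have hu : hc.index u = hc.index v + m - n * s := by omega
  rw [hu] at h0 h1
  by_cases hts : 0 ≤ t - s
  · have h3 : 0 ≤ (t - s) * (n * (n + 1)) := by positivity
    nlinarith
  have h3 : (t - s) * (n * (n + 1)) ≤ -1 * (n * (n + 1)) :=
    mul_le_mul_of_nonneg_right (by omega) (by positivity)
  have h4 : n - m ≤ d u := by
    by_contra! h5
    nlinarith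
  refine hR.asymm hvu (hc.rel_iff.2 ⟨n - m, by omega, h4, ?_⟩)
  rw [show hc.index u + (n - m) = hc.index v + n * (1 - s) by rw [hu]; ring, hc.periodic,
    hc.apply_index]

theorem helly [Finite V] (hc : IsCircularEnumeration R n h d) (hR : G.IsRoundOrientation R) :
    hc.model.Helly := by
  intro S hS
  rcases S.eq_empty_or_nonempty with rfl | hne
  · exact ⟨0, by simp⟩
  have hcl : ∀ a ∈ S, ∀ b ∈ S, a ≠ b → G.Adj a b := fun a ha b hb hab =>
    ((hc.inter_nonempty_iff.1 (hS a ha b hb)).resolve_left hab).elim hR.adj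
      fun h' => (hR.adj h').symm
  obtain ⟨x, hx, hsink⟩ := hR.swap.exists_source hne hcl
  exact ⟨hc.model.ccp x, Set.mem_iInter₂.2 fun v hv =>
    hc.ccp_mem_arc_iff.2 ((hsink v hv).imp_left Eq.symm)⟩

theorem isPHCA [Finite V] (hc : IsCircularEnumeration R n h d) (hR : G.IsRoundOrientation R) :
    G.IsPHCA := by
  refine ⟨hc.model, ⟨hc.endpointsDistinct, fun u v huv => ?_⟩, hc.proper hR, hc.helly hR⟩
  rw [hc.inter_nonempty_iff, or_iff_right huv]
  exact ⟨hR.total, fun h' => h'.elim hR.adj fun h' => (hR.adj h').symm⟩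

end IsCircularEnumeration

theorem IsClawTentNetFree.isPHCA [Finite V] (hG : G.IsClawTentNetFree) (hconn : G.Connected) :
    G.IsPHCA := by
  obtain ⟨D, hD⟩ := hG.exists_isLocalOrientation
  obtain ⟨m, ⟨e⟩⟩ := Finite.exists_equiv_fin V
  have hR := hD.isRoundOrientation (e := fun v => (e v : ℕ))
    (Fin.val_injective.comp e.injective)
  obtain ⟨n, h, d, hc⟩ := hR.exists_isCircularEnumeration hconn
  exact hc.isPHCA hR

end SimpleGraph

/-- A connected {claw, tent S_3, net, C_4, C_5}-free graph is a proper
Helly circular-arc graph. -/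
theorem stmt1 {V : Type*} [Fintype V] (G : SimpleGraph V) (hconn : G.Connected)
    (hclaw : ¬ G.HasInducedCopy clawGraph) (htent : ¬ G.HasInducedCopy tentGraph)
    (hnet : ¬ G.HasInducedCopy netGraph) (hc4 : ¬ G.HasInducedCopy (cycleG 4))
    (hc5 : ¬ G.HasInducedCopy (cycleG 5)) :
    G.IsPHCA := by
  exact (G.isClawTentNetFree_of_not_hasInducedCopy hclaw htent hnet hc4 hc5).isPHCA hconn
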